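/- arXiv:1512.03778 — 2 statements merged into one kernel-verified Lean document; each statement's English description precedes it below -/
import Mathlib

section
/- Suppose n ≥ 3, α ∈ (0,n), 0 < λ < (n−α)/(n−2), and 0 ≤ σ ≤ n/(n−2). If u is a nonnegative solution of the Choquard–Pekar inequality problem, then u(x) = O(|x|^{2−n}) as x → 0. -/
open MeasureTheory Metric Filter Set Asymptotics Topology

/-- `ℝⁿ` as a Euclidean space. -/
abbrev Euc (n : ℕ) : Type := EuclideanSpace ℝ (Fin n)

/-- The Laplacian `Δu(x) = ∑ i ∂²u/∂xᵢ²(x)`. -/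
noncomputable def lap {n : ℕ} (u : Euc n → ℝ) (x : Euc n) : ℝ :=
  ∑ i : Fin n, iteratedFDeriv ℝ 2 u x ![EuclideanSpace.single i 1, EuclideanSpace.single i 1]

/-- `u` is a nonnegative solution of the Choquard–Pekar inequality problem:
`u ∈ C²(ℝⁿ \ {0}) ∩ L^λ(ℝⁿ)` and
`0 ≤ -Δu(x) ≤ (∫ |x-y|^(-α) u(y)^λ dy) · u(x)^σ` on `B₂(0) \ {0}`. -/
def IsCPSolution (n : ℕ) (α lam sig : ℝ) (u : Euc n → ℝ) : Prop :=
  (∀ x, 0 ≤ u x) ∧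
  ContDiffOn ℝ 2 u {0}ᶜ ∧
  Integrable (fun y => u y ^ lam) ∧
  ∀ x ∈ ball (0 : Euc n) 2 \ {0},
    0 ≤ -lap u x ∧
    -lap u x ≤ (∫ y, ‖x - y‖ ^ (-α) * u y ^ lam) * u x ^ sig

lemma integrable_mul_of_continuousOn {n : ℕ} {v φ : Euc n → ℝ} {U : Set (Euc n)}
    (hU : IsOpen U) (hv : ContinuousOn v U) (hφ : Continuous φ) (hc : HasCompactSupport φ)
    (hs : tsupport φ ⊆ U) : Integrable fun x => v x * φ x := by
  have h1 : Continuous fun x => v x * φ x := by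
    refine continuous_of_tsupport fun x hx => ?_
    have hx' : x ∈ U := hs (tsupport_mul_subset_right hx)
    exact (hv.continuousAt (hU.mem_nhds hx')).mul hφ.continuousAt
  exact h1.integrable_of_hasCompactSupport hc.mul_left

lemma integral_fderiv_mul_eq_neg {n : ℕ} {v φ : Euc n → ℝ} {U : Set (Euc n)}
    (hU : IsOpen U) (hv : ContDiffOn ℝ 1 v U) (hφ : ContDiff ℝ 1 φ) (hc : HasCompactSupport φ)
    (hs : tsupport φ ⊆ U) (e : Euc n) :
    ∫ x, fderiv ℝ v x e * φ x = -∫ x, v x * fderiv ℝ φ x e := by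
  have hd : ∀ x ∈ U, DifferentiableAt ℝ v x := fun x hx =>
    (hv.contDiffAt (hU.mem_nhds hx)).differentiableAt one_ne_zero
  have hφ' : Continuous fun x => fderiv ℝ φ x e :=
    (hφ.continuous_fderiv one_ne_zero).clm_apply continuous_const
  have hv' : ContinuousOn (fun x => fderiv ℝ v x e) U :=
    (hv.continuousOn_fderiv_of_isOpen hU le_rfl).clm_apply continuousOn_const
  have hc' : HasCompactSupport fun x => fderiv ℝ φ x e := hc.fderiv_apply ℝ e
  rw [integral_mul_fderiv_eq_neg_fderiv_mul_of_integrable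
    (integrable_mul_of_continuousOn hU hv' hφ.continuous hc hs)
    (integrable_mul_of_continuousOn hU hv.continuousOn hφ' hc'
      ((tsupport_fderiv_apply_subset ℝ e).trans hs))
    (integrable_mul_of_continuousOn hU hv.continuousOn hφ.continuous hc hs)
    (fun x hx => hd x (hs hx))
    (fun x _ => (hφ.differentiable one_ne_zero) x), neg_neg]

lemma contDiffOn_fderiv_apply {n : ℕ} {u : Euc n → ℝ} {U : Set (Euc n)} (hU : IsOpen U)
    (hu : ContDiffOn ℝ 2 u U) (e : Euc n) : ContDiffOn ℝ 1 (fun x => fderiv ℝ u x e) U :=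
  (hu.fderiv_of_isOpen hU (m := 1) (by norm_num)).clm_apply contDiffOn_const

lemma lap_eq_sum {n : ℕ} {u : Euc n → ℝ} {U : Set (Euc n)} (hU : IsOpen U)
    (hu : ContDiffOn ℝ 2 u U) {x : Euc n} (hx : x ∈ U) :
    lap u x = ∑ i : Fin n, fderiv ℝ (fun y => fderiv ℝ u y (EuclideanSpace.single i 1)) x
      (EuclideanSpace.single i 1) := by
  unfold lap
  refine Finset.sum_congr rfl fun i _ => ?_
  rw [iteratedFDeriv_two_apply]
  have h : DifferentiableAt ℝ (fderiv ℝ u) x :=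
    ((hu.fderiv_of_isOpen hU (m := 1) (by norm_num)).contDiffAt
      (hU.mem_nhds hx)).differentiableAt one_ne_zero
  rw [fderiv_clm_apply h (differentiableAt_const _)]
  simp

lemma continuousOn_lap {n : ℕ} {u : Euc n → ℝ} {U : Set (Euc n)} (hU : IsOpen U)
    (hu : ContDiffOn ℝ 2 u U) : ContinuousOn (lap u) U := by
  refine ContinuousOn.congr (f := fun x => ∑ i : Fin n, fderiv ℝ (fun y => fderiv ℝ u y
    (EuclideanSpace.single i 1)) x (EuclideanSpace.single i 1)) ?_ fun x hx => lap_eq_sum hU hu hx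
  refine continuousOn_finsetSum _ fun i _ => ?_
  exact ((contDiffOn_fderiv_apply hU hu _).continuousOn_fderiv_of_isOpen hU le_rfl).clm_apply
    continuousOn_const

lemma integral_lap_mul {n : ℕ} {u φ : Euc n → ℝ} {U : Set (Euc n)}
    (hU : IsOpen U) (hu : ContDiffOn ℝ 2 u U) (hφ : ContDiff ℝ 1 φ) (hc : HasCompactSupport φ)
    (hs : tsupport φ ⊆ U) :
    ∫ x, lap u x * φ x = -∑ i : Fin n, ∫ x, fderiv ℝ u x (EuclideanSpace.single i 1) *
      fderiv ℝ φ x (EuclideanSpace.single i 1) := by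
  have h1 : ∀ x, lap u x * φ x = ∑ i : Fin n, fderiv ℝ (fun y => fderiv ℝ u y
      (EuclideanSpace.single i 1)) x (EuclideanSpace.single i 1) * φ x := by
    intro x
    by_cases hx : x ∈ U
    · rw [lap_eq_sum hU hu hx, Finset.sum_mul]
    · have : φ x = 0 := image_eq_zero_of_notMem_tsupport fun h => hx (hs h)
      simp [this]
  simp_rw [h1]
  rw [integral_finsetSum, ← Finset.sum_neg_distrib]
  · exact Finset.sum_congr rfl fun i _ => integral_fderiv_mul_eq_neg hU
      (contDiffOn_fderiv_apply hU hu _) hφ hc hs _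
  · intro i _
    exact integrable_mul_of_continuousOn hU (((contDiffOn_fderiv_apply hU hu
      _).continuousOn_fderiv_of_isOpen hU le_rfl).clm_apply continuousOn_const) hφ.continuous hc hs

/-- Green identity against a compactly supported test function. -/
lemma integral_lap_mul_eq_integral_mul_lap {n : ℕ} {u φ : Euc n → ℝ} {U : Set (Euc n)}
    (hU : IsOpen U) (hu : ContDiffOn ℝ 2 u U) (hφ : ContDiff ℝ 2 φ) (hc : HasCompactSupport φ)
    (hs : tsupport φ ⊆ U) :
    ∫ x, lap u x * φ x = ∫ x, u x * lap φ x := by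
  have hφ1 : ∀ e, ContDiff ℝ 1 fun x => fderiv ℝ φ x e := fun e =>
    (hφ.fderiv_right (m := 1) (by norm_num)).clm_apply contDiff_const
  have hc' : ∀ e, HasCompactSupport fun x => fderiv ℝ φ x e := fun e => hc.fderiv_apply ℝ e
  have hs' : ∀ e, tsupport (fun x => fderiv ℝ φ x e) ⊆ U := fun e =>
    (tsupport_fderiv_apply_subset ℝ e).trans hs
  rw [integral_lap_mul hU hu (hφ.of_le (by norm_num)) hc hs, ← Finset.sum_neg_distrib]
  have h2 : ∀ x, u x * lap φ x = ∑ i : Fin n, u x * fderiv ℝ (fun y => fderiv ℝ φ y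
      (EuclideanSpace.single i 1)) x (EuclideanSpace.single i 1) := by
    intro x
    rw [lap_eq_sum isOpen_univ hφ.contDiffOn (mem_univ x), Finset.mul_sum]
  simp_rw [h2]
  rw [integral_finsetSum]
  · refine Finset.sum_congr rfl fun i _ => ?_
    rw [integral_fderiv_mul_eq_neg hU (hu.of_le (by norm_num)) (hφ1 _) (hc' _) (hs' _), neg_neg]
  · intro i _
    refine integrable_mul_of_continuousOn hU hu.continuousOn
      (((hφ1 _).continuous_fderiv one_ne_zero).clm_apply continuous_const)
      ((hc' _).fderiv_apply ℝ _) ((tsupport_fderiv_apply_subset ℝ _).trans (hs' _))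

lemma hasDerivAt_max_zero_pow (k : ℕ) (t : ℝ) :
    HasDerivAt (fun s : ℝ => max s 0 ^ (k + 2)) ((k + 2) * max t 0 ^ (k + 1)) t := by
  rcases lt_trichotomy t 0 with ht | rfl | ht
  · have h : (fun s : ℝ => max s 0 ^ (k + 2)) =ᶠ[𝓝 t] fun _ => 0 := by
      filter_upwards [Iio_mem_nhds ht] with s hs
      simp [max_eq_right (le_of_lt (mem_Iio.1 hs))]
    simpa [max_eq_right ht.le] using (hasDerivAt_const t (0 : ℝ)).congr_of_eventuallyEq h
  · have h : (fun s : ℝ => max s 0 ^ (k + 2)) =O[𝓝 0] fun s => (s - 0) ^ 2 := by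
      refine IsBigO.of_bound 1 ?_
      filter_upwards [Metric.ball_mem_nhds (0 : ℝ) one_pos] with s hs
      have hs' : |s| < 1 := by simpa using hs
      have h0 : 0 ≤ max s 0 := le_max_right _ _
      have h1 : max s 0 ≤ |s| := max_le (le_abs_self s) (abs_nonneg s)
      rw [Real.norm_eq_abs, abs_of_nonneg (pow_nonneg h0 _), sub_zero, Real.norm_eq_abs, one_mul,
        abs_pow]
      calc max s 0 ^ (k + 2) ≤ |s| ^ (k + 2) := by gcongr
        _ ≤ |s| ^ 2 := pow_le_pow_of_le_one (abs_nonneg s) hs'.le (by omega)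
    have h2 : (fun s : ℝ => max s 0 ^ (k + 2)) =O[𝓝 0] fun s => ‖s - 0‖ ^ 2 := by
      simpa using h
    have := h2.hasFDerivAt (𝕜 := ℝ) (n := 2) one_lt_two
    simpa using this.hasDerivAt
  · have h : (fun s : ℝ => max s 0 ^ (k + 2)) =ᶠ[𝓝 t] fun s => s ^ (k + 2) := by
      filter_upwards [Ioi_mem_nhds ht] with s hs
      simp [max_eq_left (le_of_lt (mem_Ioi.1 hs))]
    have h2 := (hasDerivAt_pow (k + 2) t).congr_of_eventuallyEq h
    simpa [max_eq_left ht.le] using h2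

lemma contDiff_max_zero_sq : ContDiff ℝ 1 fun s : ℝ => max s 0 ^ 2 := by
  rw [contDiff_one_iff_deriv]
  have h : ∀ t, HasDerivAt (fun s : ℝ => max s 0 ^ 2) (2 * max t 0) t := fun t => by
    simpa using hasDerivAt_max_zero_pow 0 t
  refine ⟨fun t => (h t).differentiableAt, ?_⟩
  rw [show deriv (fun s : ℝ => max s 0 ^ 2) = fun t => 2 * max t 0 from funext fun t => (h t).deriv]
  fun_prop

lemma contDiff_max_zero_cube : ContDiff ℝ 2 fun s : ℝ => max s 0 ^ 3 := by
  have h : ∀ t, HasDerivAt (fun s : ℝ => max s 0 ^ 3) (3 * max t 0 ^ 2) t := fun t => by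
    have := hasDerivAt_max_zero_pow 1 t
    norm_num at this
    exact this
  rw [show (2 : WithTop ℕ∞) = 1 + 1 by norm_num, contDiff_succ_iff_deriv]
  refine ⟨fun t => (h t).differentiableAt, by simp, ?_⟩
  rw [show deriv (fun s : ℝ => max s 0 ^ 3) = fun t => 3 * max t 0 ^ 2 from
    funext fun t => (h t).deriv]
  exact contDiff_const.mul contDiff_max_zero_sq

lemma hasFDerivAt_norm_rpow_of_ne {n : ℕ} {y : Euc n} (hy : y ≠ 0) (p : ℝ) :
    HasFDerivAt (fun z : Euc n => ‖z‖ ^ p) ((p * ‖y‖ ^ (p - 2)) • innerSL ℝ y) y := by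
  have h1 : HasFDerivAt (fun z : Euc n => ‖z‖ ^ 2) (2 • innerSL ℝ y) y :=
    (hasStrictFDerivAt_norm_sq y).hasFDerivAt
  have hpos : 0 < ‖y‖ := norm_pos_iff.2 hy
  have h2 := h1.rpow_const (p := p / 2) (Or.inl (by positivity))
  have h3 : (fun z : Euc n => ‖z‖ ^ p) = fun z => (‖z‖ ^ 2) ^ (p / 2) := by
    funext z
    rw [← Real.rpow_natCast, ← Real.rpow_mul (norm_nonneg _)]
    congr 1; push_cast; ring
  rw [h3]
  convert! h2 using 1
  rw [← Real.rpow_natCast, ← Real.rpow_mul (norm_nonneg _)]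
  ext z
  simp
  rw [show 2 * (p / 2 - 1) = p - 2 by ring]
  ring

lemma contDiffAt_norm_rpow_of_ne {n : ℕ} {y : Euc n} (hy : y ≠ 0) (p : ℝ) :
    ContDiffAt ℝ 2 (fun z : Euc n => ‖z‖ ^ p) y :=
  (contDiffAt_norm ℝ hy).rpow_const_of_ne (norm_ne_zero_iff.2 hy)

/-- The Laplacian of a function of the fundamental solution `‖y‖ ^ (2 - n)`. -/
lemma lap_comp_norm_rpow {n : ℕ} {G G' G'' : ℝ → ℝ} (hGc : ContDiff ℝ 2 G)
    (hG : ∀ t, HasDerivAt G (G' t) t)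
    (hG' : ∀ t, HasDerivAt G' (G'' t) t) {y : Euc n} (hy : y ≠ 0) :
    lap (fun z : Euc n => G (‖z‖ ^ (2 - (n : ℝ)))) y =
      G'' (‖y‖ ^ (2 - (n : ℝ))) * (((n : ℝ) - 2) ^ 2 * ‖y‖ ^ (2 - 2 * (n : ℝ))) := by
  have hpos : 0 < ‖y‖ := norm_pos_iff.2 hy
  have hU : IsOpen ({0}ᶜ : Set (Euc n)) := isOpen_compl_singleton
  have hc : ContDiffOn ℝ 2 (fun z : Euc n => G (‖z‖ ^ (2 - (n : ℝ)))) {0}ᶜ := fun z hz =>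
    (hGc.contDiffAt.comp z (contDiffAt_norm_rpow_of_ne hz _)).contDiffWithinAt
  rw [lap_eq_sum hU hc hy]
  set e : Fin n → Euc n := fun i => EuclideanSpace.single i 1 with he
  have hτ : ∀ z : Euc n, z ≠ 0 → HasFDerivAt (fun z : Euc n => ‖z‖ ^ (2 - (n : ℝ)))
      (((2 - (n : ℝ)) * ‖z‖ ^ (-(n : ℝ))) • innerSL ℝ z) z := fun z hz => by
    have := hasFDerivAt_norm_rpow_of_ne hz (2 - (n : ℝ))
    rwa [show 2 - (n : ℝ) - 2 = -n by ring] at this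
  have h1 : ∀ i, ∀ z : Euc n, z ≠ 0 → fderiv ℝ (fun z : Euc n => G (‖z‖ ^ (2 - (n : ℝ)))) z (e i) =
      G' (‖z‖ ^ (2 - (n : ℝ))) * ((2 - (n : ℝ)) * (‖z‖ ^ (-(n : ℝ)) * z i)) := by
    intro i z hz
    have := (hG (‖z‖ ^ (2 - (n : ℝ)))).comp_hasFDerivAt z (hτ z hz)
    rw [HasFDerivAt.fderiv (f := fun z : Euc n => G (‖z‖ ^ (2 - (n : ℝ)))) this]
    simp only [he, _root_.smul_apply, innerSL_apply_apply,
      EuclideanSpace.inner_single_right, smul_eq_mul, one_mul, conj_trivial]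
    ring
  have h2 : ∀ i, fderiv ℝ (fun y => fderiv ℝ (fun z : Euc n => G (‖z‖ ^ (2 - (n : ℝ)))) y (e i)) y
      (e i) = G'' (‖y‖ ^ (2 - (n : ℝ))) * ((2 - (n : ℝ)) * ‖y‖ ^ (-(n : ℝ))) ^ 2 * y i ^ 2 +
        G' (‖y‖ ^ (2 - (n : ℝ))) * (2 - (n : ℝ)) *
          (‖y‖ ^ (-(n : ℝ)) - n * ‖y‖ ^ (-(n : ℝ) - 2) * y i ^ 2) := by
    intro i
    have hev : (fun y => fderiv ℝ (fun z : Euc n => G (‖z‖ ^ (2 - (n : ℝ)))) y (e i)) =ᶠ[𝓝 y]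
        fun z => G' (‖z‖ ^ (2 - (n : ℝ))) * ((2 - (n : ℝ)) * (‖z‖ ^ (-(n : ℝ)) * z i)) := by
      filter_upwards [hU.mem_nhds hy] with z hz using h1 i z hz
    rw [hev.fderiv_eq]
    have hd1 := (hG' (‖y‖ ^ (2 - (n : ℝ)))).comp_hasFDerivAt y (hτ y hy)
    have hd2 := hasFDerivAt_norm_rpow_of_ne hy (-(n : ℝ))
    have hd3 : HasFDerivAt (fun z : Euc n => z i) (EuclideanSpace.proj (𝕜 := ℝ) i) y :=
      (EuclideanSpace.proj (𝕜 := ℝ) i : Euc n →L[ℝ] ℝ).hasFDerivAt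
    have hd := hd1.mul ((hd2.mul hd3).const_mul (2 - (n : ℝ)))
    rw [HasFDerivAt.fderiv (f := fun z : Euc n =>
      G' (‖z‖ ^ (2 - (n : ℝ))) * ((2 - (n : ℝ)) * (‖z‖ ^ (-(n : ℝ)) * z i))) hd]
    simp [he, EuclideanSpace.inner_single_right]
    ring
  rw [Finset.sum_congr rfl fun i _ => h2 i, Finset.sum_add_distrib, ← Finset.mul_sum,
    ← Finset.mul_sum, Finset.sum_sub_distrib, ← Finset.mul_sum]
  have h3 : ∑ i, y i ^ 2 = ‖y‖ ^ 2 := by rw [EuclideanSpace.real_norm_sq_eq]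
  have h4 : ‖y‖ ^ (-(n : ℝ) - 2) * ‖y‖ ^ 2 = ‖y‖ ^ (-(n : ℝ)) := by
    rw [← Real.rpow_natCast, ← Real.rpow_add hpos]; congr 1; push_cast; ring
  have h5 : (‖y‖ ^ (-(n : ℝ))) ^ 2 * ‖y‖ ^ 2 = ‖y‖ ^ (2 - 2 * (n : ℝ)) := by
    rw [← Real.rpow_natCast, ← Real.rpow_natCast, ← Real.rpow_mul hpos.le, ← Real.rpow_add hpos]
    congr 1; push_cast; ring
  rw [h3]
  simp only [Finset.sum_const, Finset.card_univ, Fintype.card_fin, nsmul_eq_mul]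
  rw [mul_assoc (n : ℝ), h4, ← h5]
  ring

/-- A one-dimensional cutoff, constant to the left of `a` and to the right of `b`. -/
lemma exists_cutoff {a b : ℝ} (hab : a < b) : ∃ K : ℝ → ℝ, ContDiff ℝ 2 K ∧ (∀ t, 0 ≤ K t) ∧
    (∀ t, K t ≤ 1) ∧ (∀ t ≤ a, K t = 0) ∧ (∀ t, b ≤ t → K t = 1) := by
  have hba : 0 < b - a := sub_pos.2 hab
  refine ⟨fun t => Real.smoothTransition ((t - a) / (b - a)), ?_, fun t =>
    Real.smoothTransition.nonneg _, fun t => Real.smoothTransition.le_one _, fun t ht => ?_,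
    fun t ht => ?_⟩
  · exact Real.smoothTransition.contDiff.comp (by fun_prop)
  · exact Real.smoothTransition.zero_of_nonpos (div_nonpos_of_nonpos_of_nonneg (by linarith) hba.le)
  · exact Real.smoothTransition.one_of_one_le ((one_le_div hba).2 (by linarith))

/-- The test functions behind the a priori bounds near the singularity: for each scale `r` there is
a test function supported in a fixed punctured ball whose Laplacian is bounded below by `r⁻²` at
scale `r`, nonnegative in the unit ball, and bounded below away from it. -/
lemma exists_test_function {n : ℕ} (hn : 3 ≤ n) : ∃ c > 0, ∃ C ≥ 0, ∀ r : ℝ, 0 < r → r ≤ 1 →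
    ∃ φ : Euc n → ℝ, ContDiff ℝ 2 φ ∧ HasCompactSupport φ ∧
      tsupport φ ⊆ ball 0 2 \ {0} ∧ (∀ y, 0 ≤ φ y) ∧
      (∀ y, r ≤ ‖y‖ → ‖y‖ < 1 → c ≤ φ y) ∧
      (∀ y, y ≠ 0 → ‖y‖ < 1 → 0 ≤ lap φ y) ∧
      (∀ y, r ≤ ‖y‖ → ‖y‖ ≤ 4 * r → ‖y‖ < 1 → c * r ^ (-2 : ℝ) ≤ lap φ y) ∧
      (∀ y, 1 ≤ ‖y‖ → -C ≤ lap φ y) ∧ (∀ y, 3 / 2 < ‖y‖ → lap φ y = 0) := by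
  have hn' : (3 : ℝ) ≤ n := by exact_mod_cast hn
  set m : ℝ := (n : ℝ) - 2 with hm
  have hm1 : 1 ≤ m := by rw [hm]; linarith
  have hm0 : 0 < m := by linarith
  set a : ℝ := (3 / 2 : ℝ) ^ (-m) with ha
  have ha0 : 0 < a := by positivity
  have ha1 : a < 1 := Real.rpow_lt_one_of_one_lt_of_neg (by norm_num) (by linarith)
  obtain ⟨K, hKc, hK0, hK1, hKa, hKb⟩ := exists_cutoff ha1
  set K' := deriv K
  set K'' := deriv (deriv K)
  have hKc' : ContDiff ℝ 1 K' := by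
    have : ContDiff ℝ (1 + 1) K := hKc
    exact (contDiff_succ_iff_deriv.1 this).2.2
  have hK' : ∀ t, HasDerivAt K (K' t) t := fun t =>
    ((hKc.differentiable (by norm_num)) t).hasDerivAt
  have hK'' : ∀ t, HasDerivAt K' (K'' t) t := fun t =>
    ((hKc'.differentiable (by norm_num)) t).hasDerivAt
  have hK''c : Continuous K'' := hKc'.continuous_deriv le_rfl
  obtain ⟨M1, hM1⟩ := (isCompact_Icc (a := a) (b := 1)).exists_bound_of_continuousOn
    hKc'.continuous.continuousOn
  obtain ⟨M2, hM2⟩ := (isCompact_Icc (a := a) (b := 1)).exists_bound_of_continuousOn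
    hK''c.continuousOn
  have hM1n : 0 ≤ M1 := (norm_nonneg _).trans (hM1 1 ⟨ha1.le, le_rfl⟩)
  have hM2n : 0 ≤ M2 := (norm_nonneg _).trans (hM2 1 ⟨ha1.le, le_rfl⟩)
  set c2 : ℝ := (8 : ℝ) ^ (-m) with hc2
  have hc2p : 0 < c2 := by positivity
  refine ⟨min (1 / 8) (3 * c2 ^ 2 / 16), by positivity, (6 * M1 + M2) * m ^ 2, by positivity, ?_⟩
  intro r hr hr1
  set δ : ℝ := (r / 2) ^ m with hδ
  have hδ0 : 0 < δ := by positivity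
  have hδ1 : δ ≤ 1 := Real.rpow_le_one (by positivity) (by linarith) hm0.le
  set τ : Euc n → ℝ := fun y => ‖y‖ ^ (2 - (n : ℝ)) with hτ
  have hnm : 2 - (n : ℝ) = -m := by rw [hm]; ring
  have hδτ : ∀ y : Euc n, y ≠ 0 → δ * τ y = (r / (2 * ‖y‖)) ^ m := by
    intro y hy
    have : 0 < ‖y‖ := norm_pos_iff.2 hy
    simp only [hδ, hτ, hnm]
    rw [Real.rpow_neg this.le, ← div_eq_mul_inv, ← Real.div_rpow (by positivity) this.le, div_div]
  set P : ℝ → ℝ := fun t => max (1 - δ * t) 0 ^ 3 with hP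
  have hlin : ∀ t, HasDerivAt (fun t : ℝ => 1 - δ * t) (-δ) t := fun t => by
    simpa using ((hasDerivAt_id t).const_mul δ).const_sub 1
  have hP' : ∀ t, HasDerivAt P (-3 * δ * max (1 - δ * t) 0 ^ 2) t := fun t => by
    have := (hasDerivAt_max_zero_pow 1 (1 - δ * t)).comp t (hlin t)
    norm_num at this
    convert! this using 1
    ring
  have hP'' : ∀ t, HasDerivAt (fun t => -3 * δ * max (1 - δ * t) 0 ^ 2)
      (6 * δ ^ 2 * max (1 - δ * t) 0) t := fun t => by
    have := ((hasDerivAt_max_zero_pow 0 (1 - δ * t)).comp t (hlin t)).const_mul (-3 * δ)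
    norm_num at this
    convert! this using 1
    · norm_num
    · ring
  have hPc : ContDiff ℝ 2 P := contDiff_max_zero_cube.comp (by fun_prop)
  set G : ℝ → ℝ := fun t => P t * K t with hG
  have hGc : ContDiff ℝ 2 G := hPc.mul hKc
  have hG' := fun t => (hP' t).mul (hK' t)
  have hG'' := fun t => ((hP'' t).mul (hK' t)).add ((hP' t).mul (hK'' t))
  have hlap := fun (y : Euc n) (hy : y ≠ 0) => lap_comp_norm_rpow (n := n) hGc hG' hG'' hy
  have hKder : ∀ t, 1 < t → K' t = 0 ∧ K'' t = 0 := by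
    intro t ht
    have h1 : ∀ s, 1 < s → K' s = 0 := fun s hs => by
      have : K =ᶠ[𝓝 s] fun _ => 1 := by
        filter_upwards [Ioi_mem_nhds hs] with x hx using hKb x (le_of_lt (mem_Ioi.1 hx))
      simpa using this.deriv_eq
    refine ⟨h1 t ht, ?_⟩
    have : K' =ᶠ[𝓝 t] fun _ => 0 := by
      filter_upwards [Ioi_mem_nhds ht] with x hx using h1 x hx
    simpa using this.deriv_eq
  have hKdera : ∀ t, t < a → K' t = 0 ∧ K'' t = 0 := by
    intro t ht
    have h1 : ∀ s, s < a → K' s = 0 := fun s hs => by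
      have : K =ᶠ[𝓝 s] fun _ => 0 := by
        filter_upwards [Iio_mem_nhds hs] with x hx using hKa x (le_of_lt (mem_Iio.1 hx))
      simpa using this.deriv_eq
    refine ⟨h1 t ht, ?_⟩
    have : K' =ᶠ[𝓝 t] fun _ => 0 := by
      filter_upwards [Iio_mem_nhds ht] with x hx using h1 x hx
    simpa using this.deriv_eq
  have hτ1 : ∀ y : Euc n, y ≠ 0 → ‖y‖ < 1 → 1 < τ y := fun y hy hy1 =>
    Real.one_lt_rpow_of_pos_of_lt_one_of_neg (norm_pos_iff.2 hy) hy1 (by linarith)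
  have hτa : ∀ y : Euc n, 3 / 2 < ‖y‖ → τ y < a := fun y hy => by
    simp only [hτ, ha, hnm]
    exact Real.rpow_lt_rpow_of_neg (by norm_num) hy (by linarith)
  have hnz : ∀ y : Euc n, r ≤ ‖y‖ → y ≠ 0 := fun y hy => norm_pos_iff.1 (hr.trans_le hy)
  have hhalf : ∀ y : Euc n, r ≤ ‖y‖ → δ * τ y ≤ 1 / 2 := fun y hy => by
    have hyp : 0 < ‖y‖ := hr.trans_le hy
    rw [hδτ y (hnz y hy)]
    have h1 : r / (2 * ‖y‖) ≤ 1 / 2 := by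
      rw [div_le_div_iff₀ (by positivity) (by norm_num)]; linarith
    calc (r / (2 * ‖y‖)) ^ m ≤ (1 / 2) ^ m := Real.rpow_le_rpow (by positivity) h1 hm0.le
      _ ≤ (1 / 2) ^ (1 : ℝ) := Real.rpow_le_rpow_of_exponent_ge (by norm_num) (by norm_num) hm1
      _ = 1 / 2 := by norm_num
  have hlap1 : ∀ y : Euc n, y ≠ 0 → ‖y‖ < 1 → lap (fun z : Euc n => G (τ z)) y =
      6 * m ^ 2 * max (1 - δ * τ y) 0 * ((δ * τ y) ^ 2 * ‖y‖ ^ (-2 : ℝ)) := by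
    intro y hy hy1
    have hyp : 0 < ‖y‖ := norm_pos_iff.2 hy
    refine (hlap y hy).trans ?_
    obtain ⟨h1, h2⟩ := hKder _ (hτ1 y hy hy1)
    have h3 := hKb _ (hτ1 y hy hy1).le
    have h4 : ‖y‖ ^ (2 - 2 * (n : ℝ)) = τ y ^ 2 * ‖y‖ ^ (-2 : ℝ) := by
      simp only [hτ]
      rw [← Real.rpow_natCast, ← Real.rpow_mul hyp.le, ← Real.rpow_add hyp]
      congr 1; push_cast; ring
    rw [h4]
    simp only [hτ] at h1 h2 h3 ⊢
    rw [h1, h2, h3]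
    ring
  set φ : Euc n → ℝ := fun y => G (τ y) with hφ
  have hsupp : tsupport φ ⊆ {y | r / 2 ≤ ‖y‖ ∧ ‖y‖ ≤ 3 / 2} := by
    refine closure_minimal (fun y hy => ?_) ((isClosed_le continuous_const continuous_norm).inter
      (isClosed_le continuous_norm continuous_const))
    have hy' : P (τ y) * K (τ y) ≠ 0 := hy
    have hP0 := left_ne_zero_of_mul hy'
    have hK0 := right_ne_zero_of_mul hy'
    have hy0 : y ≠ 0 := by
      rintro rfl
      apply hK0
      apply hKa
      simp only [hτ, norm_zero]
      rw [Real.zero_rpow (by linarith)]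
      exact ha0.le
    have hyp : 0 < ‖y‖ := norm_pos_iff.2 hy0
    constructor
    · by_contra! h
      apply hP0
      have : 1 ≤ δ * τ y := by
        rw [hδτ y hy0]
        exact Real.one_le_rpow (by rw [one_le_div (by positivity)]; linarith) hm0.le
      simp only [hP]
      rw [max_eq_right (by linarith)]
      norm_num
    · by_contra! h
      exact hK0 (hKa _ (hτa y h).le)
  have hts : tsupport φ ⊆ ball 0 2 \ {0} := fun y hy => by
    have := hsupp hy
    refine ⟨by simpa using this.2.trans_lt (by norm_num), ?_⟩
    rintro rfl
    have h1 := this.1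
    rw [norm_zero] at h1
    linarith
  have hPnn : ∀ t, 0 ≤ P t := fun t => pow_nonneg (le_max_right _ _) _
  refine ⟨φ, ?_, ?_, hts, fun y => mul_nonneg (hPnn _) (hK0 _), ?_, ?_, ?_, ?_, ?_⟩
  · refine contDiff_iff_contDiffAt.2 fun y => ?_
    by_cases hy : y = 0
    · have : y ∉ tsupport φ := fun h => (hts h).2 hy
      exact contDiffAt_const.congr_of_eventuallyEq (notMem_tsupport_iff_eventuallyEq.1 this)
    · exact hGc.contDiffAt.comp y (contDiffAt_norm_rpow_of_ne hy _)
  · refine HasCompactSupport.of_support_subset_isCompact (isCompact_closedBall (0 : Euc n) 2) ?_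
    exact ((subset_tsupport φ).trans hts).trans (sdiff_subset.trans ball_subset_closedBall)
  · intro y hy hy1
    have h1 := hhalf y hy
    have hy0 := hnz y hy
    simp only [hφ, hG]
    rw [hKb _ (hτ1 y hy0 hy1).le, mul_one]
    refine (min_le_left _ _).trans ?_
    simp only [hP]
    rw [max_eq_left (by linarith)]
    calc (1 / 8 : ℝ) = (1 / 2) ^ 3 := by norm_num
      _ ≤ (1 - δ * τ y) ^ 3 := by gcongr; linarith
  · intro y hy hy1
    rw [hlap1 y hy hy1]
    have := le_max_right (1 - δ * τ y) 0
    positivity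
  · intro y hy hy4 hy1
    have hy0 := hnz y hy
    have hyp : 0 < ‖y‖ := hr.trans_le hy
    have h1 := hhalf y hy
    rw [hlap1 y hy0 hy1, max_eq_left (by linarith)]
    have h2 : c2 ≤ δ * τ y := by
      rw [hδτ y hy0, hc2, Real.rpow_neg (by norm_num), ← Real.inv_rpow (by norm_num)]
      refine Real.rpow_le_rpow (by norm_num) ?_ hm0.le
      rw [inv_eq_one_div, div_le_div_iff₀ (by norm_num) (by positivity)]
      linarith
    have h3 : r ^ (-2 : ℝ) / 16 ≤ ‖y‖ ^ (-2 : ℝ) := by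
      have : (4 * r) ^ (-2 : ℝ) ≤ ‖y‖ ^ (-2 : ℝ) :=
        Real.rpow_le_rpow_of_nonpos hyp hy4 (by norm_num)
      rw [Real.mul_rpow (by norm_num) hr.le] at this
      norm_num [Real.rpow_neg] at this ⊢
      linarith
    calc min (1 / 8) (3 * c2 ^ 2 / 16) * r ^ (-2 : ℝ) ≤ (3 * c2 ^ 2 / 16) * r ^ (-2 : ℝ) := by
          gcongr; exact min_le_right _ _
      _ = 6 * 1 ^ 2 * (1 / 2) * (c2 ^ 2 * (r ^ (-2 : ℝ) / 16)) := by ring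
      _ ≤ 6 * m ^ 2 * (1 - δ * τ y) * ((δ * τ y) ^ 2 * ‖y‖ ^ (-2 : ℝ)) := by
          have h5 : 0 ≤ 1 - δ * τ y := by linarith
          have h6 : 0 ≤ 6 * m ^ 2 * (1 - δ * τ y) := by positivity
          gcongr
          linarith
  · intro y hy1
    have hyp : 0 < ‖y‖ := by linarith
    have hy0 : y ≠ 0 := norm_pos_iff.1 hyp
    have hpow : ‖y‖ ^ (2 - 2 * (n : ℝ)) ≤ 1 :=
      Real.rpow_le_one_of_one_le_of_nonpos hy1 (by linarith)
    have hpow0 : 0 ≤ ‖y‖ ^ (2 - 2 * (n : ℝ)) := by positivity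
    have hτ1' : τ y ≤ 1 := Real.rpow_le_one_of_one_le_of_nonpos hy1 (by linarith)
    have hτ0 : 0 < τ y := by simp only [hτ]; positivity
    rw [hlap y hy0]
    change _ ≤ (6 * δ ^ 2 * max (1 - δ * τ y) 0 * K (τ y) + -3 * δ * max (1 - δ * τ y) 0 ^ 2 *
      K' (τ y) + (-3 * δ * max (1 - δ * τ y) 0 ^ 2 * K' (τ y) + P (τ y) * K'' (τ y))) *
      (m ^ 2 * ‖y‖ ^ (2 - 2 * (n : ℝ)))
    have hb1 : ‖K' (τ y)‖ ≤ M1 ∧ ‖K'' (τ y)‖ ≤ M2 := by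
      by_cases h : a ≤ τ y
      · exact ⟨hM1 _ ⟨h, hτ1'⟩, hM2 _ ⟨h, hτ1'⟩⟩
      · obtain ⟨h1, h2⟩ := hKdera _ (not_le.1 h)
        rw [h1, h2]; simpa using ⟨hM1n, hM2n⟩
    rw [Real.norm_eq_abs, abs_le, Real.norm_eq_abs, abs_le] at hb1
    set w := max (1 - δ * τ y) 0 with hw
    have hw0 : 0 ≤ w := le_max_right _ _
    have hw1 : w ≤ 1 := max_le (by have := mul_pos hδ0 hτ0; linarith) zero_le_one
    have hPw : P (τ y) = w ^ 3 := rfl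
    have hK0y := hK0 (τ y)
    have hA : 0 ≤ 6 * δ ^ 2 * w * K (τ y) := by positivity
    have hq : δ * w ^ 2 ≤ 1 := mul_le_one₀ hδ1 (by positivity) (pow_le_one₀ hw0 hw1)
    have hq0 : 0 ≤ δ * w ^ 2 := by positivity
    have hB : δ * w ^ 2 * K' (τ y) ≤ M1 := by nlinarith [hb1.1.2]
    have hw3 : w ^ 3 ≤ 1 := pow_le_one₀ hw0 hw1
    have hw30 : 0 ≤ w ^ 3 := by positivity
    have hC : -M2 ≤ P (τ y) * K'' (τ y) := by rw [hPw]; nlinarith [hb1.2.1]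
    have hT : -(6 * M1 + M2) ≤ 6 * δ ^ 2 * w * K (τ y) + -3 * δ * w ^ 2 *
      K' (τ y) + (-3 * δ * w ^ 2 * K' (τ y) + P (τ y) * K'' (τ y)) := by linarith
    have hm2 : 0 ≤ m ^ 2 := by positivity
    calc -((6 * M1 + M2) * m ^ 2) ≤ -(6 * M1 + M2) * (m ^ 2 * ‖y‖ ^ (2 - 2 * (n : ℝ))) := by
          have : m ^ 2 * ‖y‖ ^ (2 - 2 * (n : ℝ)) ≤ m ^ 2 := mul_le_of_le_one_right hm2 hpow
          nlinarith
      _ ≤ _ := mul_le_mul_of_nonneg_right hT (by positivity)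
  · intro y hy
    have hy0 : y ≠ 0 := norm_pos_iff.1 (by linarith)
    rw [hlap y hy0]
    obtain ⟨h1, h2⟩ := hKdera _ (hτa y hy)
    have h3 := hKa _ (hτa y hy).le
    simp only [hτ] at h1 h2 h3
    rw [h1, h2, h3]
    ring

lemma integrableOn_of_continuousOn_compl_zero {n : ℕ} {g : Euc n → ℝ}
    (hg : ContinuousOn g {0}ᶜ) {r R : ℝ} (hr : 0 < r) {S : Set (Euc n)}
    (hS : S ⊆ {y | r ≤ ‖y‖ ∧ ‖y‖ ≤ R}) : IntegrableOn g S := by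
  have hK : IsCompact {y : Euc n | r ≤ ‖y‖ ∧ ‖y‖ ≤ R} := by
    refine (isCompact_closedBall (0 : Euc n) R).of_isClosed_subset
      ((isClosed_le continuous_const continuous_norm).inter
      (isClosed_le continuous_norm continuous_const)) fun y hy => ?_
    simpa using hy.2
  refine IntegrableOn.mono_set ((hg.mono fun y hy => ?_).integrableOn_compact hK) hS
  rintro rfl
  have := hy.1
  rw [norm_zero] at this
  linarith

/-- A priori bounds for nonnegative superharmonic functions in a punctured ball. -/
lemma exists_annulus_bound {n : ℕ} (hn : 3 ≤ n) {u : Euc n → ℝ} (hu0 : ∀ x, 0 ≤ u x)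
    (hu : ContDiffOn ℝ 2 u {0}ᶜ) (hsup : ∀ x ∈ ball (0 : Euc n) 2 \ {0}, 0 ≤ -lap u x) :
    ∃ C ≥ 0, ∀ r : ℝ, 0 < r → r ≤ 1 →
      (∫ y in {y : Euc n | r ≤ ‖y‖ ∧ ‖y‖ < 1}, -lap u y) ≤ C ∧
      (∫ y in {y : Euc n | r ≤ ‖y‖ ∧ ‖y‖ ≤ 4 * r ∧ ‖y‖ < 1}, u y) ≤ C * r ^ 2 := by
  obtain ⟨c, hc, C, hC, htest⟩ := exists_test_function hn
  set O : Set (Euc n) := {y | 1 ≤ ‖y‖ ∧ ‖y‖ ≤ 3 / 2} with hO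
  set I : ℝ := ∫ y in O, u y with hI
  have hOm : MeasurableSet O := (measurableSet_le measurable_const measurable_norm).inter
    (measurableSet_le measurable_norm measurable_const)
  have hI0 : 0 ≤ I := integral_nonneg fun y => hu0 y
  have hopen : IsOpen ({0}ᶜ : Set (Euc n)) := isOpen_compl_singleton
  have : Nonempty (Fin n) := ⟨⟨0, by omega⟩⟩
  refine ⟨C * I / c, by positivity, fun r hr hr1 => ?_⟩
  obtain ⟨φ, hφ, hcs, hts, hφ0, hφc, hl0, hlc, hlC, hlO⟩ := htest r hr hr1
  have hts' : tsupport φ ⊆ {0}ᶜ := fun y hy => (hts hy).2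
  have hlapc : Continuous (lap φ) := by
    rw [← continuousOn_univ]; exact continuousOn_lap isOpen_univ hφ.contDiffOn
  set A : Set (Euc n) := {y | r ≤ ‖y‖ ∧ ‖y‖ < 1} with hA
  set B : Set (Euc n) := {y | r ≤ ‖y‖ ∧ ‖y‖ ≤ 4 * r ∧ ‖y‖ < 1} with hB
  have hAm : MeasurableSet A := (measurableSet_le measurable_const measurable_norm).inter
    (measurableSet_lt measurable_norm measurable_const)
  have hBm : MeasurableSet B := (measurableSet_le measurable_const measurable_norm).inter
    ((measurableSet_le measurable_norm measurable_const).inter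
    (measurableSet_lt measurable_norm measurable_const))
  have hlu := continuousOn_lap hopen hu
  have hAi : IntegrableOn (fun y => -lap u y) A :=
    integrableOn_of_continuousOn_compl_zero hlu.neg hr (R := 1) fun y hy => ⟨hy.1, hy.2.le⟩
  have hBi : IntegrableOn u B :=
    integrableOn_of_continuousOn_compl_zero hu.continuousOn hr (R := 1) fun y hy =>
      ⟨hy.1, hy.2.2.le⟩
  have hOi : IntegrableOn u O :=
    integrableOn_of_continuousOn_compl_zero hu.continuousOn one_pos (R := 3 / 2) fun y hy => hy
  have hgreen := integral_lap_mul_eq_integral_mul_lap hopen hu hφ hcs hts'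
  have hint1 : Integrable fun y => lap u y * φ y :=
    integrable_mul_of_continuousOn hopen hlu hφ.continuous hcs hts'
  have htl : tsupport (lap φ) ⊆ tsupport φ := by
    refine closure_minimal (fun y hy => ?_) (isClosed_tsupport φ)
    by_contra h
    apply hy
    have h1 : φ =ᶠ[𝓝 y] 0 := notMem_tsupport_iff_eventuallyEq.1 h
    have h2 := h1.iteratedFDeriv ℝ 2
    simp only [lap]
    refine Finset.sum_eq_zero fun i _ => ?_
    rw [h2.eq_of_nhds]
    simp
  have hint2 : Integrable fun y => u y * lap φ y :=
    integrable_mul_of_continuousOn hopen hu.continuousOn hlapc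
      (hcs.of_isClosed_subset (isClosed_tsupport _) htl) (htl.trans hts')
  have hF : ∀ y, 0 ≤ -lap u y * φ y := fun y => by
    by_cases hy : y ∈ tsupport φ
    · exact mul_nonneg (hsup y (hts hy)) (hφ0 y)
    · rw [image_eq_zero_of_notMem_tsupport hy, mul_zero]
  have hpt : ∀ᵐ y : Euc n, c * A.indicator (fun y => -lap u y) y +
      c * r ^ (-2 : ℝ) * B.indicator u y ≤
      -lap u y * φ y + u y * lap φ y + C * O.indicator u y := by
    filter_upwards [compl_mem_ae_iff.2 (measure_singleton (0 : Euc n))] with y hy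
    have hy0 : y ≠ 0 := hy
    have h1 : c * A.indicator (fun y => -lap u y) y ≤ -lap u y * φ y := by
      by_cases hyA : y ∈ A
      · rw [indicator_of_mem hyA, mul_comm]
        refine mul_le_mul_of_nonneg_left (hφc y hyA.1 hyA.2) (hsup y ⟨?_, hy0⟩)
        simpa using hyA.2.trans one_lt_two
      · rw [indicator_of_notMem hyA, mul_zero]; exact hF y
    have h2 : c * r ^ (-2 : ℝ) * B.indicator u y ≤ u y * lap φ y + C * O.indicator u y := by
      have hOn : 0 ≤ O.indicator u y := indicator_nonneg (fun y _ => hu0 y) y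
      by_cases hyB : y ∈ B
      · rw [indicator_of_mem hyB, mul_comm]
        have := mul_le_mul_of_nonneg_left (hlc y hyB.1 hyB.2.1 hyB.2.2) (hu0 y)
        have := mul_nonneg hC hOn
        linarith
      · rw [indicator_of_notMem hyB, mul_zero]
        by_cases hy1 : ‖y‖ < 1
        · have := mul_nonneg (hu0 y) (hl0 y hy0 hy1)
          have := mul_nonneg hC hOn
          linarith
        · by_cases hy2 : 3 / 2 < ‖y‖
          · rw [hlO y hy2]
            have := mul_nonneg hC hOn
            linarith
          · rw [indicator_of_mem (show y ∈ O from ⟨not_lt.1 hy1, not_lt.1 hy2⟩)]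
            have := mul_le_mul_of_nonneg_left (hlC y (not_lt.1 hy1)) (hu0 y)
            linarith
    linarith
  have hi1 : Integrable fun y => c * A.indicator (fun y => -lap u y) y :=
    (hAi.integrable_indicator hAm).const_mul c
  have hi2 : Integrable fun y => c * r ^ (-2 : ℝ) * B.indicator u y :=
    (hBi.integrable_indicator hBm).const_mul _
  have hi3 : Integrable fun y => -lap u y * φ y := by simpa using hint1.neg
  have hi4 : Integrable fun y => C * O.indicator u y := (hOi.integrable_indicator hOm).const_mul C
  have hi5 : Integrable fun y => -lap u y * φ y + u y * lap φ y := hi3.add hint2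
  have hkey := integral_mono_ae (hi1.add hi2) (hi5.add hi4) hpt
  simp only [Pi.add_apply] at hkey
  rw [integral_add hi1 hi2, integral_const_mul, integral_const_mul, integral_indicator hAm,
    integral_indicator hBm, integral_add hi5 hi4, integral_add hi3 hint2, integral_const_mul,
    integral_indicator hOm] at hkey
  have hneg : ∫ y, -lap u y * φ y = -∫ y, lap u y * φ y := by
    rw [← integral_neg]; simp
  rw [hneg, hgreen, neg_add_cancel, zero_add, ← hI] at hkey
  have hA0 : 0 ≤ ∫ y in A, -lap u y := setIntegral_nonneg hAm fun y hy => hsup y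
    ⟨by simpa using hy.2.trans one_lt_two, norm_pos_iff.1 (hr.trans_le hy.1)⟩
  have hB0 : 0 ≤ ∫ y in B, u y := integral_nonneg fun y => hu0 y
  have hr2 : 0 < r ^ (-2 : ℝ) := by positivity
  constructor
  · rw [le_div_iff₀ hc]
    have : 0 ≤ c * r ^ (-2 : ℝ) * ∫ y in B, u y := by positivity
    linarith
  · have h1 : c * r ^ (-2 : ℝ) * ∫ y in B, u y ≤ C * I := by
      have : 0 ≤ c * ∫ y in A, -lap u y := by positivity
      linarith
    rw [div_mul_eq_mul_div, le_div_iff₀ hc]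
    have h2 : r ^ (-2 : ℝ) * r ^ 2 = 1 := by
      rw [← Real.rpow_natCast, ← Real.rpow_add hr]; norm_num
    calc (∫ y in B, u y) * c = (c * r ^ (-2 : ℝ) * ∫ y in B, u y) * r ^ 2 := by
          linear_combination (-(∫ y in B, u y) * c) * h2
      _ ≤ C * I * r ^ 2 := by gcongr

lemma integrableOn_neg_lap {n : ℕ} (hn : 3 ≤ n) {u : Euc n → ℝ} (hu0 : ∀ x, 0 ≤ u x)
    (hu : ContDiffOn ℝ 2 u {0}ᶜ) (hsup : ∀ x ∈ ball (0 : Euc n) 2 \ {0}, 0 ≤ -lap u x) :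
    IntegrableOn (fun y => -lap u y) (ball 0 1) := by
  obtain ⟨C, hC, hb⟩ := exists_annulus_bound hn hu0 hu hsup
  have hlu := (continuousOn_lap isOpen_compl_singleton hu).neg
  have : Nonempty (Fin n) := ⟨⟨0, by omega⟩⟩
  set S : ℕ → Set (Euc n) := fun i => {y | 1 / ((i : ℝ) + 1) ≤ ‖y‖} with hS
  have hpos : ∀ i : ℕ, 0 < 1 / ((i : ℝ) + 1) := fun i => by positivity
  have hSm : ∀ i, MeasurableSet (S i) := fun i => measurableSet_le measurable_const measurable_norm
  have heq : ∀ i, S i ∩ ball 0 1 = {y : Euc n | 1 / ((i : ℝ) + 1) ≤ ‖y‖ ∧ ‖y‖ < 1} := by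
    intro i; ext y; simp [hS]
  have hcov : AECover (volume.restrict (ball (0 : Euc n) 1)) atTop S := by
    refine ⟨?_, hSm⟩
    refine ae_restrict_of_ae ?_
    filter_upwards [compl_mem_ae_iff.2 (measure_singleton (0 : Euc n))] with y hy
    have hyp : 0 < ‖y‖ := norm_pos_iff.2 hy
    have := (tendsto_one_div_add_atTop_nhds_zero_nat (𝕜 := ℝ)).eventually_le_const hyp
    exact this
  refine hcov.integrable_of_integral_norm_bounded C (fun i => ?_) (Eventually.of_forall fun i => ?_)
  · rw [IntegrableOn, Measure.restrict_restrict (hSm i), heq i]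
    exact integrableOn_of_continuousOn_compl_zero hlu (hpos i) (R := 1) fun y hy =>
      ⟨hy.1, hy.2.le⟩
  · rw [Measure.restrict_restrict (hSm i), heq i]
    refine le_trans (le_of_eq ?_) (hb _ (hpos i) ?_).1
    · refine setIntegral_congr_fun ?_ fun y hy => ?_
      · rw [← heq i]; exact (hSm i).inter measurableSet_ball
      · refine Real.norm_of_nonneg (hsup y ⟨?_, norm_pos_iff.1 ((hpos i).trans_le hy.1)⟩)
        simpa using hy.2.trans one_lt_two
    · rw [div_le_one (by positivity)]
      have : (0 : ℝ) ≤ i := Nat.cast_nonneg i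
      linarith

/-- The weight used for smoothed averages on balls. -/
noncomputable def ballWeight {n : ℕ} (y : Euc n) : ℝ := 4 * max (1 - ‖y‖ ^ 2) 0

/-- The potential of `ballWeight`: its gradient at `y` is `-ballWeight y • y`. -/
noncomputable def ballPotential {n : ℕ} (y : Euc n) : ℝ := max (1 - ‖y‖ ^ 2) 0 ^ 2

lemma ballWeight_nonneg {n : ℕ} (y : Euc n) : 0 ≤ ballWeight y :=
  mul_nonneg (by norm_num) (le_max_right _ _)

lemma ballWeight_le {n : ℕ} (y : Euc n) : ballWeight y ≤ 4 := by
  have : max (1 - ‖y‖ ^ 2) 0 ≤ 1 := max_le (by nlinarith [norm_nonneg y]) zero_le_one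
  unfold ballWeight; linarith

lemma ballPotential_nonneg {n : ℕ} (y : Euc n) : 0 ≤ ballPotential y := sq_nonneg _

lemma ballPotential_le {n : ℕ} (y : Euc n) : ballPotential y ≤ 1 :=
  pow_le_one₀ (le_max_right _ _) (max_le (by nlinarith [norm_nonneg y]) zero_le_one)

lemma ballWeight_eq_zero {n : ℕ} {y : Euc n} (hy : 1 ≤ ‖y‖) : ballWeight y = 0 := by
  unfold ballWeight; rw [max_eq_right (by nlinarith)]; ring

lemma ballPotential_eq_zero {n : ℕ} {y : Euc n} (hy : 1 ≤ ‖y‖) : ballPotential y = 0 := by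
  unfold ballPotential; rw [max_eq_right (by nlinarith)]; ring

lemma continuous_ballWeight {n : ℕ} : Continuous (ballWeight : Euc n → ℝ) := by
  unfold ballWeight; fun_prop

lemma contDiff_ballPotential {n : ℕ} : ContDiff ℝ 1 (ballPotential : Euc n → ℝ) :=
  contDiff_max_zero_sq.comp (contDiff_const.sub (contDiff_norm_sq ℝ))

lemma tsupport_subset_closedBall_of {n : ℕ} {φ : Euc n → ℝ} (h : ∀ y, 1 ≤ ‖y‖ → φ y = 0) :
    tsupport φ ⊆ closedBall 0 1 :=
  closure_minimal (fun y hy => by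
    by_contra h'
    exact hy (h y (by simpa using le_of_lt (not_le.1 (by simpa using h'))))) isClosed_closedBall

lemma hasCompactSupport_of_closedBall {n : ℕ} {φ : Euc n → ℝ} (h : ∀ y, 1 ≤ ‖y‖ → φ y = 0) :
    HasCompactSupport φ :=
  (isCompact_closedBall (0 : Euc n) 1).of_isClosed_subset (isClosed_tsupport _)
    (tsupport_subset_closedBall_of h)

lemma fderiv_ballPotential {n : ℕ} (y e : Euc n) :
    fderiv ℝ ballPotential y e = -(ballWeight y * inner ℝ y e) := by
  have h1 : HasFDerivAt (fun z : Euc n => 1 - ‖z‖ ^ 2) (-(2 • innerSL ℝ y)) y :=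
    (hasStrictFDerivAt_norm_sq y).hasFDerivAt.const_sub 1
  have h2 := (hasDerivAt_max_zero_pow 0 (1 - ‖y‖ ^ 2)).comp_hasFDerivAt y h1
  have h3 : HasFDerivAt (ballPotential : Euc n → ℝ) _ y := h2
  rw [h3.fderiv]
  simp [ballWeight]
  ring

lemma sum_fderiv_mul_fderiv_ballPotential {n : ℕ} (v : Euc n → ℝ) (y : Euc n) :
    ∑ i : Fin n, fderiv ℝ v y (EuclideanSpace.single i 1) *
      fderiv ℝ ballPotential y (EuclideanSpace.single i 1) = -(fderiv ℝ v y y * ballWeight y) := by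
  have hy : fderiv ℝ v y y = ∑ i : Fin n, y i * fderiv ℝ v y (EuclideanSpace.single i 1) := by
    conv_lhs => enter [2]; rw [← (EuclideanSpace.basisFun (Fin n) ℝ).sum_repr y]
    simp
  rw [hy, Finset.sum_mul, ← Finset.sum_neg_distrib]
  refine Finset.sum_congr rfl fun i _ => ?_
  rw [fderiv_ballPotential]
  simp [EuclideanSpace.inner_single_right]
  ring

lemma fderiv_comp_add_smul {n : ℕ} {v : Euc n → ℝ} {x y : Euc n} {t : ℝ}
    (hv : DifferentiableAt ℝ v (x + t • y)) (e : Euc n) :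
    fderiv ℝ (fun z => v (x + t • z)) y e = t * fderiv ℝ v (x + t • y) e := by
  have h1 : HasFDerivAt (fun z : Euc n => x + t • z) (t • ContinuousLinearMap.id ℝ (Euc n)) y :=
    ((hasFDerivAt_id y).const_smul t).const_add x
  have h2 : HasFDerivAt (fun z => v (x + t • z)) _ y := hv.hasFDerivAt.comp y h1
  rw [h2.fderiv]
  simp

lemma lap_comp_add_smul {n : ℕ} {u : Euc n → ℝ} {U : Set (Euc n)} (hU : IsOpen U)
    (hu : ContDiffOn ℝ 2 u U) {x y : Euc n} {t : ℝ} (hy : x + t • y ∈ U) :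
    lap (fun z => u (x + t • z)) y = t ^ 2 * lap u (x + t • y) := by
  have hcont : Continuous fun z : Euc n => x + t • z := by fun_prop
  have hV : IsOpen ((fun z : Euc n => x + t • z) ⁻¹' U) := hU.preimage hcont
  have hc : ContDiffOn ℝ 2 (fun z => u (x + t • z)) ((fun z : Euc n => x + t • z) ⁻¹' U) :=
    hu.comp (by fun_prop) fun z hz => hz
  rw [lap_eq_sum hV hc hy, lap_eq_sum hU hu hy, Finset.mul_sum]
  refine Finset.sum_congr rfl fun i _ => ?_
  set e : Euc n := EuclideanSpace.single i 1
  have hev : (fun z => fderiv ℝ (fun z => u (x + t • z)) z e) =ᶠ[𝓝 y]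
      fun z => t * (fun w => fderiv ℝ u w e) (x + t • z) := by
    filter_upwards [hV.mem_nhds hy] with z hz
    exact fderiv_comp_add_smul ((hu.contDiffAt (hU.mem_nhds hz)).differentiableAt (by norm_num)) e
  have hd : DifferentiableAt ℝ (fun w => fderiv ℝ u w e) (x + t • y) :=
    ((contDiffOn_fderiv_apply hU hu e).contDiffAt (hU.mem_nhds hy)).differentiableAt one_ne_zero
  have hd' : DifferentiableAt ℝ (fun z => (fun w => fderiv ℝ u w e) (x + t • z)) y :=
    DifferentiableAt.comp y (f := fun z : Euc n => x + t • z) hd (by fun_prop)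
  rw [hev.fderiv_eq, fderiv_const_mul hd', _root_.smul_apply, fderiv_comp_add_smul hd,
    smul_eq_mul]
  ring

lemma add_smul_ne_zero {n : ℕ} {x y : Euc n} {t : ℝ} (ht : |t| < ‖x‖) (hy : ‖y‖ ≤ 1) :
    x + t • y ≠ 0 := fun h => by
  have h1 : ‖x‖ = |t| * ‖y‖ := by
    rw [eq_neg_of_add_eq_zero_left h, norm_neg, norm_smul, Real.norm_eq_abs]
  have := mul_le_of_le_one_right (abs_nonneg t) hy
  linarith

/-- Smoothed average of `u` over the ball of radius `t` around `x` (not normalized). -/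
noncomputable def ballAverage {n : ℕ} (u : Euc n → ℝ) (x : Euc n) (t : ℝ) : ℝ :=
  ∫ y, u (x + t • y) * ballWeight y

lemma integrable_comp_add_smul_mul {n : ℕ} {g w : Euc n → ℝ} (hg : ContinuousOn g {0}ᶜ)
    (hw : Continuous w) (hw0 : ∀ y, 1 ≤ ‖y‖ → w y = 0) {x : Euc n} {t : ℝ} (ht : |t| < ‖x‖) :
    Integrable fun y => g (x + t • y) * w y := by
  have hcont : Continuous fun z : Euc n => x + t • z := by fun_prop
  refine integrable_mul_of_continuousOn (U := (fun z : Euc n => x + t • z) ⁻¹' {0}ᶜ)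
    (isOpen_compl_singleton.preimage hcont) (hg.comp hcont.continuousOn fun z hz => hz) hw
    (hasCompactSupport_of_closedBall hw0) fun y hy => ?_
  exact add_smul_ne_zero ht (by simpa using tsupport_subset_closedBall_of hw0 hy)

lemma integral_comp_add_smul {n : ℕ} (g : Euc n → ℝ) (x : Euc n) {t : ℝ} (ht : 0 < t) :
    ∫ y, g (x + t • y) = t ^ (-(n : ℝ)) * ∫ y, g y := by
  have h1 := Measure.integral_comp_smul_of_nonneg (volume : Measure (Euc n))
    (fun z => g (x + z)) t (hR := ht.le)
  rw [h1, integral_add_left_eq_self (μ := volume) g x]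
  simp [Real.rpow_neg ht.le]

lemma integral_comp_add_smul_mul_le {n : ℕ} {g w : Euc n → ℝ} (hg : ContinuousOn g {0}ᶜ)
    {x : Euc n} {t : ℝ} (ht0 : 0 < t) (ht : t < ‖x‖) (hg0 : ∀ z ∈ ball x t, 0 ≤ g z) {c : ℝ}
    (hwc : Continuous w) (hw0 : ∀ y, 1 ≤ ‖y‖ → w y = 0) (hw : ∀ y, w y ≤ c) :
    ∫ y, g (x + t • y) * w y ≤ c * (t ^ (-(n : ℝ)) * ∫ z in ball x t, g z) := by
  have hint := integrable_comp_add_smul_mul hg hwc hw0 (x := x) (t := t)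
    (by rwa [abs_of_pos ht0])
  have hgi : IntegrableOn g (ball x t) := by
    refine ((hg.mono fun z hz => ?_).integrableOn_compact
      (isCompact_closedBall x t)).mono_set ball_subset_closedBall
    rintro rfl
    have : ‖x‖ ≤ t := by simpa [dist_comm] using hz
    linarith
  have hi : Integrable ((ball x t).indicator g) := hgi.integrable_indicator measurableSet_ball
  rw [← integral_indicator measurableSet_ball, ← integral_comp_add_smul _ x ht0,
    ← integral_const_mul]
  refine integral_mono hint (((hi.comp_add_left x).comp_smul ht0.ne').const_mul c) fun y => ?_
  simp only
  by_cases hy : ‖y‖ < 1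
  · have hmem : x + t • y ∈ ball x t := by
      rw [mem_ball, dist_eq_norm, add_sub_cancel_left, norm_smul, Real.norm_of_nonneg ht0.le]
      exact mul_lt_of_lt_one_right ht0 hy
    rw [indicator_of_mem hmem, mul_comm]
    exact mul_le_mul_of_nonneg_right (hw y) (hg0 _ hmem)
  · have hmem : x + t • y ∉ ball x t := by
      rw [mem_ball, dist_eq_norm, add_sub_cancel_left, norm_smul, Real.norm_of_nonneg ht0.le,
        not_lt]
      exact le_mul_of_one_le_right ht0.le (not_lt.1 hy)
    rw [indicator_of_notMem hmem, hw0 y (not_lt.1 hy)]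
    simp

lemma hasDerivAt_ballAverage {n : ℕ} {u : Euc n → ℝ} (hu : ContDiffOn ℝ 2 u {0}ᶜ) {x : Euc n}
    {t : ℝ} (ht : |t| < ‖x‖) :
    HasDerivAt (ballAverage u x) (∫ y, fderiv ℝ u (x + t • y) y * ballWeight y) t := by
  obtain ⟨s, hts, hsx⟩ := exists_between ht
  have hopen : IsOpen ({0}ᶜ : Set (Euc n)) := isOpen_compl_singleton
  have hfd : ContinuousOn (fderiv ℝ u) {0}ᶜ := hu.continuousOn_fderiv_of_isOpen hopen (by norm_num)
  have hsub : closedBall x s ⊆ {0}ᶜ := by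
    rintro z hz rfl
    have : ‖x‖ ≤ s := by simpa [dist_comm] using hz
    linarith
  obtain ⟨M, hM⟩ := (isCompact_closedBall x s).exists_bound_of_continuousOn (hfd.mono hsub)
  have hnhds : {r : ℝ | |r| < s} ∈ 𝓝 t := (isOpen_lt continuous_abs continuous_const).mem_nhds hts
  have hM0 : 0 ≤ M := (norm_nonneg _).trans (hM x (mem_closedBall_self
    ((abs_nonneg t).trans hts.le)))
  refine (hasDerivAt_integral_of_dominated_loc_of_deriv_le (bound := fun y => M * ballWeight y)
    (F' := fun t y => fderiv ℝ u (x + t • y) y * ballWeight y) hnhds ?_ ?_ ?_ ?_ ?_ ?_).2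
  · filter_upwards [hnhds] with r hr
    exact (integrable_comp_add_smul_mul hu.continuousOn continuous_ballWeight
      (fun y => ballWeight_eq_zero) (hr.trans hsx)).aestronglyMeasurable
  · exact integrable_comp_add_smul_mul hu.continuousOn continuous_ballWeight
      (fun y => ballWeight_eq_zero) ht
  · have hcont : Continuous fun z : Euc n => x + t • z := by fun_prop
    refine (integrable_mul_of_continuousOn (U := (fun z : Euc n => x + t • z) ⁻¹' {0}ᶜ)
      (v := fun y => fderiv ℝ u (x + t • y) y) (hopen.preimage hcont)
      ((hfd.comp hcont.continuousOn fun z hz => hz).clm_apply continuousOn_id)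
      continuous_ballWeight (hasCompactSupport_of_closedBall fun y => ballWeight_eq_zero)
      fun y hy => ?_).aestronglyMeasurable
    exact add_smul_ne_zero ht (by
      simpa using tsupport_subset_closedBall_of (fun y => ballWeight_eq_zero) hy)
  · refine ae_of_all _ fun y r hr => ?_
    rw [norm_mul, Real.norm_of_nonneg (ballWeight_nonneg y)]
    by_cases hy : 1 ≤ ‖y‖
    · rw [ballWeight_eq_zero hy]; simp
    · refine mul_le_mul_of_nonneg_right ?_ (ballWeight_nonneg y)
      have hy' := (not_le.1 hy).le
      refine ((fderiv ℝ u (x + r • y)).le_opNorm y).trans ?_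
      refine (mul_le_of_le_one_right (norm_nonneg _) hy').trans (hM _ ?_)
      rw [mem_closedBall, dist_eq_norm, add_sub_cancel_left, norm_smul, Real.norm_eq_abs]
      exact (mul_le_of_le_one_right (abs_nonneg r) hy').trans (le_of_lt hr)
  · exact (continuous_ballWeight.integrable_of_hasCompactSupport
      (hasCompactSupport_of_closedBall fun y => ballWeight_eq_zero)).const_mul M
  · refine ae_of_all _ fun y r hr => ?_
    by_cases hy : 1 ≤ ‖y‖
    · simp only [ballWeight_eq_zero hy, mul_zero]
      exact hasDerivAt_const _ _
    · have hne : x + r • y ≠ 0 := add_smul_ne_zero (hr.trans hsx) (not_le.1 hy).le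
      have hd : HasFDerivAt u (fderiv ℝ u (x + r • y)) (x + r • y) :=
        ((hu.contDiffAt (hopen.mem_nhds hne)).differentiableAt (by norm_num)).hasFDerivAt
      have h1 : HasDerivAt (fun r : ℝ => x + r • y) y r := by
        simpa using ((hasDerivAt_id r).smul_const y).const_add x
      exact (hd.comp_hasDerivAt r h1).mul_const _

lemma integral_fderiv_mul_ballWeight {n : ℕ} {u : Euc n → ℝ} (hu : ContDiffOn ℝ 2 u {0}ᶜ)
    {x : Euc n} {t : ℝ} (ht0 : t ≠ 0) (ht : |t| < ‖x‖) :
    ∫ y, fderiv ℝ u (x + t • y) y * ballWeight y =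
      t * ∫ y, lap u (x + t • y) * ballPotential y := by
  have hopen : IsOpen ({0}ᶜ : Set (Euc n)) := isOpen_compl_singleton
  have hcont : Continuous fun z : Euc n => x + t • z := by fun_prop
  set U := (fun z : Euc n => x + t • z) ⁻¹' {0}ᶜ with hU
  have hUo : IsOpen U := hopen.preimage hcont
  have hc : ContDiffOn ℝ 2 (fun z => u (x + t • z)) U := hu.comp (by fun_prop) fun z hz => hz
  have hmem : ∀ y : Euc n, ‖y‖ ≤ 1 → y ∈ U := fun y hy => add_smul_ne_zero ht hy
  have hts : tsupport (ballPotential : Euc n → ℝ) ⊆ U := fun y hy => hmem y (by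
    simpa using tsupport_subset_closedBall_of (fun y => ballPotential_eq_zero) hy)
  have hcs : HasCompactSupport (ballPotential : Euc n → ℝ) :=
    hasCompactSupport_of_closedBall fun y => ballPotential_eq_zero
  have hibp := integral_lap_mul hUo hc contDiff_ballPotential hcs hts
  rw [← integral_finsetSum, ← integral_neg] at hibp
  · simp_rw [sum_fderiv_mul_fderiv_ballPotential, neg_neg] at hibp
    have h1 : ∫ y, lap (fun z => u (x + t • z)) y * ballPotential y =
        t ^ 2 * ∫ y, lap u (x + t • y) * ballPotential y := by
      rw [← integral_const_mul]
      refine integral_congr_ae (ae_of_all _ fun y => ?_)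
      by_cases hy : 1 ≤ ‖y‖
      · simp [ballPotential_eq_zero hy]
      · simp only
        rw [lap_comp_add_smul hopen hu (hmem y (not_le.1 hy).le), mul_assoc]
    have h2 : ∫ y, fderiv ℝ (fun z => u (x + t • z)) y y * ballWeight y =
        t * ∫ y, fderiv ℝ u (x + t • y) y * ballWeight y := by
      rw [← integral_const_mul]
      refine integral_congr_ae (ae_of_all _ fun y => ?_)
      by_cases hy : 1 ≤ ‖y‖
      · simp [ballWeight_eq_zero hy]
      · simp only
        rw [fderiv_comp_add_smul ((hu.contDiffAt (hopen.mem_nhds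
          (hmem y (not_le.1 hy).le))).differentiableAt (by norm_num)), mul_assoc]
    rw [h1, h2] at hibp
    apply mul_left_cancel₀ ht0
    rw [← hibp]
    ring
  · intro i _
    refine integrable_mul_of_continuousOn hUo
      (contDiffOn_fderiv_apply hUo hc _).continuousOn ((contDiff_ballPotential.continuous_fderiv
        one_ne_zero).clm_apply continuous_const) (hcs.fderiv_apply ℝ _)
        ((tsupport_fderiv_apply_subset ℝ _).trans hts)

lemma ballAverage_zero {n : ℕ} (u : Euc n → ℝ) (x : Euc n) :
    ballAverage u x 0 = (∫ y : Euc n, ballWeight y) * u x := by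
  simp [ballAverage, integral_const_mul, mul_comm]

lemma integral_ballWeight_pos (n : ℕ) : 0 < ∫ y : Euc n, ballWeight y := by
  refine Continuous.integral_pos_of_hasCompactSupport_nonneg_nonzero continuous_ballWeight
    (hasCompactSupport_of_closedBall fun y => ballWeight_eq_zero) ballWeight_nonneg (x := 0) ?_
  simp [ballWeight]

lemma volume_real_ball {n : ℕ} (x : Euc n) {t : ℝ} (ht : 0 < t) :
    volume.real (ball x t) = t ^ (n : ℝ) * volume.real (ball (0 : Euc n) 1) := by
  rw [Measure.real, Measure.addHaar_ball_of_pos _ x ht, ENNReal.toReal_mul,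
    ENNReal.toReal_ofReal (by positivity), finrank_euclideanSpace, Fintype.card_fin,
    Real.rpow_natCast]
  rfl

/-- The negative of the derivative of `ballAverage u x`. -/
noncomputable def ballFlux {n : ℕ} (u : Euc n → ℝ) (x : Euc n) (t : ℝ) : ℝ :=
  t * ∫ y, -lap u (x + t • y) * ballPotential y

lemma hasDerivAt_ballAverage_neg_ballFlux {n : ℕ} {u : Euc n → ℝ} (hu : ContDiffOn ℝ 2 u {0}ᶜ)
    {x : Euc n} {t : ℝ} (ht0 : 0 < t) (ht : t < ‖x‖) :
    HasDerivAt (ballAverage u x) (-ballFlux u x t) t := by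
  have ht' : |t| < ‖x‖ := by rwa [abs_of_pos ht0]
  have h := hasDerivAt_ballAverage hu ht'
  rw [integral_fderiv_mul_ballWeight hu ht0.ne' ht'] at h
  convert h using 1
  simp [ballFlux, integral_neg]

lemma continuousOn_ballAverage {n : ℕ} {u : Euc n → ℝ} (hu : ContDiffOn ℝ 2 u {0}ᶜ)
    {x : Euc n} {s : ℝ} (hs : s < ‖x‖) : ContinuousOn (ballAverage u x) (Icc 0 s) := fun t ht =>
  (hasDerivAt_ballAverage hu (by
    rw [abs_of_nonneg ht.1]; exact ht.2.trans_lt hs)).continuousAt.continuousWithinAt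

lemma ballFlux_nonneg {n : ℕ} {u : Euc n → ℝ} {x : Euc n} {t : ℝ} (ht0 : 0 < t)
    (hf0 : ∀ z ∈ ball x t, 0 ≤ -lap u z) : 0 ≤ ballFlux u x t := by
  refine mul_nonneg ht0.le (integral_nonneg fun y => ?_)
  by_cases hy : 1 ≤ ‖y‖
  · simp [ballPotential_eq_zero hy]
  · refine mul_nonneg (hf0 _ ?_) (ballPotential_nonneg y)
    rw [mem_ball, dist_eq_norm, add_sub_cancel_left, norm_smul, Real.norm_of_nonneg ht0.le]
    exact mul_lt_of_lt_one_right ht0 (not_le.1 hy)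

lemma ballFlux_le {n : ℕ} {u : Euc n → ℝ} (hu : ContDiffOn ℝ 2 u {0}ᶜ)
    {x : Euc n} {t : ℝ} (ht0 : 0 < t) (ht : t < ‖x‖)
    (hf0 : ∀ z ∈ ball x t, 0 ≤ -lap u z) :
    ballFlux u x t ≤ t ^ (1 - (n : ℝ)) * ∫ z in ball x t, -lap u z := by
  have h := integral_comp_add_smul_mul_le (w := ballPotential) (c := 1)
    (continuousOn_lap isOpen_compl_singleton hu).neg ht0 ht hf0
    contDiff_ballPotential.continuous (fun y => ballPotential_eq_zero) ballPotential_le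
  have := mul_le_mul_of_nonneg_left h ht0.le
  refine this.trans (le_of_eq ?_)
  rw [sub_eq_add_neg, Real.rpow_add ht0, Real.rpow_one]
  simp only [Pi.neg_apply]
  ring

lemma ball_subset_compl_zero {n : ℕ} {x : Euc n} {t : ℝ} (ht : t < ‖x‖) :
    closedBall x t ⊆ {0}ᶜ := by
  rintro z hz rfl
  have : ‖x‖ ≤ t := by simpa [dist_comm] using hz
  linarith

lemma integrableOn_ball_neg_lap {n : ℕ} {u : Euc n → ℝ} (hu : ContDiffOn ℝ 2 u {0}ᶜ)
    {x : Euc n} {t : ℝ} (ht : t < ‖x‖) : IntegrableOn (fun z => -lap u z) (ball x t) :=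
  (((continuousOn_lap isOpen_compl_singleton hu).neg.mono
    (ball_subset_compl_zero ht)).integrableOn_compact
      (isCompact_closedBall x t)).mono_set ball_subset_closedBall

/-- Mean value estimate combining a pointwise bound and an integral bound on `-Δu`. -/
lemma ballAverage_zero_le {n : ℕ} (hn : 3 ≤ n) {u : Euc n → ℝ} (hu : ContDiffOn ℝ 2 u {0}ᶜ)
    {x : Euc n} {s F η τ : ℝ} (hs0 : 0 < s) (hs : s < ‖x‖) (hτ : 0 < τ)
    (hf0 : ∀ z ∈ ball x s, 0 ≤ -lap u z) (hF : ∀ z ∈ ball x s, -lap u z ≤ F)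
    (hη : ∫ z in ball x s, -lap u z ≤ η) :
    ballAverage u x 0 ≤ ballAverage u x s + F * volume.real (ball (0 : Euc n) 1) * τ ^ 2
      + η * τ ^ (2 - (n : ℝ)) / (n - 2) := by
  have hn' : (0 : ℝ) < n - 2 := by
    have : (3 : ℝ) ≤ n := by exact_mod_cast hn
    linarith
  set V := volume.real (ball (0 : Euc n) 1) with hV
  have hV0 : 0 ≤ V := measureReal_nonneg
  have hF0 : 0 ≤ F := (hf0 x (mem_ball_self hs0)).trans (hF x (mem_ball_self hs0))
  have hη0 : 0 ≤ η := (setIntegral_nonneg measurableSet_ball hf0).trans hη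
  have hD : ∀ t, 0 < t → t < s → ballFlux u x t ≤ t ^ (1 - (n : ℝ)) * ∫ z in ball x t, -lap u z :=
    fun t ht0 hts => ballFlux_le hu ht0 (hts.trans hs) fun z hz => hf0 z (ball_subset_ball hts.le hz)
  have hD1 : ∀ t, 0 < t → t < s → ballFlux u x t ≤ F * V * t := by
    intro t ht0 hts
    refine (hD t ht0 hts).trans ?_
    have h1 : ∫ z in ball x t, -lap u z ≤ F * (t ^ (n : ℝ) * V) := by
      have := setIntegral_mono_on (integrableOn_ball_neg_lap hu (hts.trans hs))
        (integrableOn_const (C := F) (measure_ball_lt_top (x := x) (r := t)).ne) measurableSet_ball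
        fun z hz => hF z (ball_subset_ball hts.le hz)
      refine this.trans (le_of_eq ?_)
      rw [setIntegral_const, smul_eq_mul, volume_real_ball x ht0, mul_comm]
    refine (mul_le_mul_of_nonneg_left h1 (by positivity)).trans (le_of_eq ?_)
    have h2 : t ^ (1 - (n : ℝ)) * t ^ (n : ℝ) = t := by
      rw [← Real.rpow_add ht0]; simp
    linear_combination (F * V) * h2
  have hD2 : ∀ t, 0 < t → t < s → ballFlux u x t ≤ η * t ^ (1 - (n : ℝ)) := by
    intro t ht0 hts
    refine (hD t ht0 hts).trans ?_
    rw [mul_comm]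
    refine mul_le_mul_of_nonneg_right ((setIntegral_mono_set (integrableOn_ball_neg_lap hu hs)
      ?_ (ball_subset_ball hts.le).eventuallyLE).trans hη) (by positivity)
    exact (ae_restrict_iff' measurableSet_ball).2 (ae_of_all _ hf0)
  have hderiv : ∀ t, 0 < t → t < s → HasDerivAt (ballAverage u x) (-ballFlux u x t) t :=
    fun t ht0 hts => hasDerivAt_ballAverage_neg_ballFlux hu ht0 (hts.trans hs)
  have hcont := continuousOn_ballAverage hu hs
  set m := min τ s with hm
  have hm0 : 0 < m := lt_min hτ hs0
  have hms : m ≤ s := min_le_right _ _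
  have hA : ballAverage u x 0 ≤ ballAverage u x m + F * V * m ^ 2 := by
    have hd : ∀ t ∈ Ioo 0 m, HasDerivAt (fun t => ballAverage u x t + F * V * t ^ 2)
        (-ballFlux u x t + F * V * (2 * t)) t := fun t ht => by
      refine ((hderiv t ht.1 (ht.2.trans_le hms)).add
        ((hasDerivAt_pow 2 t).const_mul (F * V))).congr_deriv ?_
      simp
    have hmono : MonotoneOn (fun t => ballAverage u x t + F * V * t ^ 2) (Icc 0 m) := by
      refine monotoneOn_of_deriv_nonneg (convex_Icc 0 m)
        ((hcont.mono (Icc_subset_Icc_right hms)).add (by fun_prop)) ?_ ?_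
      · rw [interior_Icc]
        exact fun t ht => (hd t ht).differentiableAt.differentiableWithinAt
      · rw [interior_Icc]
        intro t ht
        rw [(hd t ht).deriv]
        have := hD1 t ht.1 (ht.2.trans_le hms)
        have h3 : 0 ≤ F * V * t := by have := ht.1; positivity
        linarith
    simpa using hmono (left_mem_Icc.2 hm0.le) (right_mem_Icc.2 hm0.le) hm0.le
  have hB : ballAverage u x m - η * m ^ (2 - (n : ℝ)) / (n - 2) ≤
      ballAverage u x s - η * s ^ (2 - (n : ℝ)) / (n - 2) := by
    have hd : ∀ t ∈ Ioo m s, HasDerivAt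
        (fun t => ballAverage u x t - η * t ^ (2 - (n : ℝ)) / (n - 2))
        (-ballFlux u x t + η * t ^ (1 - (n : ℝ))) t := fun t ht => by
      have h1 := (((Real.hasDerivAt_rpow_const (p := 2 - (n : ℝ))
        (Or.inl (hm0.trans ht.1).ne')).const_mul η).div_const ((n : ℝ) - 2))
      refine ((hderiv t (hm0.trans ht.1) ht.2).sub h1).congr_deriv ?_
      rw [show 2 - (n : ℝ) - 1 = 1 - n by ring]
      field_simp
      ring
    have hmono : MonotoneOn (fun t => ballAverage u x t - η * t ^ (2 - (n : ℝ)) / (n - 2))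
        (Icc m s) := by
      refine monotoneOn_of_deriv_nonneg (convex_Icc m s)
        ((hcont.mono (Icc_subset_Icc_left hm0.le)).sub ?_) ?_ ?_
      · refine (continuousOn_const.mul (continuousOn_id.rpow_const fun t ht => ?_)).div_const _
        exact Or.inl (hm0.trans_le ht.1).ne'
      · rw [interior_Icc]
        exact fun t ht => (hd t ht).differentiableAt.differentiableWithinAt
      · rw [interior_Icc]
        intro t ht
        rw [(hd t ht).deriv]
        have := hD2 t (hm0.trans ht.1) ht.2
        linarith
    exact hmono (left_mem_Icc.2 hms) (right_mem_Icc.2 hms) hms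
  have h1 : F * V * m ^ 2 ≤ F * V * τ ^ 2 := by gcongr; exact min_le_left _ _
  have h2 : η * m ^ (2 - (n : ℝ)) / (n - 2) ≤
      η * s ^ (2 - (n : ℝ)) / (n - 2) + η * τ ^ (2 - (n : ℝ)) / (n - 2) := by
    have e1 : 0 ≤ η * s ^ (2 - (n : ℝ)) / (n - 2) := by positivity
    have e2 : 0 ≤ η * τ ^ (2 - (n : ℝ)) / (n - 2) := by positivity
    rcases min_choice τ s with h | h <;> rw [hm, h] <;> linarith
  linarith

lemma ballAverage_le {n : ℕ} {u : Euc n → ℝ} (hu : ContDiffOn ℝ 2 u {0}ᶜ) (hu0 : ∀ x, 0 ≤ u x)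
    {x : Euc n} {s : ℝ} (hs0 : 0 < s) (hs : s < ‖x‖) :
    ballAverage u x s ≤ 4 * (s ^ (-(n : ℝ)) * ∫ z in ball x s, u z) :=
  integral_comp_add_smul_mul_le hu.continuousOn hs0 hs (fun z _ => hu0 z) continuous_ballWeight
    (fun _ => ballWeight_eq_zero) ballWeight_le

lemma lintegral_rpow_Ioo_le {n : ℕ} (hn : 3 ≤ n) {ρ : ℝ} (hρ : 0 < ρ) (s : ℝ) :
    ∫⁻ t in Ioo 0 s, (Ioi ρ).indicator (fun t => ENNReal.ofReal (t ^ (1 - (n : ℝ)))) t ≤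
      ENNReal.ofReal (ρ ^ (2 - (n : ℝ)) / (n - 2)) := by
  have hn' : (3 : ℝ) ≤ n := by exact_mod_cast hn
  have h1 : 1 - (n : ℝ) < -1 := by linarith
  have h2 := integral_Ioi_rpow_of_lt h1 hρ
  have h3 : ∫ t in Ioi ρ, t ^ (1 - (n : ℝ)) = ρ ^ (2 - (n : ℝ)) / (n - 2) := by
    rw [h2, show 1 - (n : ℝ) + 1 = 2 - n by ring, ← neg_div_neg_eq, neg_neg, neg_sub]
  rw [← h3, ofReal_integral_eq_lintegral_ofReal (integrableOn_Ioi_rpow_of_lt h1 hρ)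
    ((ae_restrict_iff' measurableSet_Ioi).2 (ae_of_all _ fun t ht =>
      Real.rpow_nonneg (hρ.trans ht).le _)), ← lintegral_indicator measurableSet_Ioi]
  exact setLIntegral_le_lintegral _ _

/-- Newtonian potential estimate for superharmonic functions. -/
lemma ofReal_ballAverage_zero_le {n : ℕ} (hn : 3 ≤ n) {u : Euc n → ℝ}
    (hu : ContDiffOn ℝ 2 u {0}ᶜ) {x : Euc n} {s : ℝ} (hs0 : 0 < s) (hs : s < ‖x‖)
    (hf0 : ∀ z ∈ ball x s, 0 ≤ -lap u z) :
    ENNReal.ofReal (ballAverage u x 0) ≤ ENNReal.ofReal (ballAverage u x s) +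
      ∫⁻ z in ball x s, ENNReal.ofReal (-lap u z) *
        ENNReal.ofReal (‖z - x‖ ^ (2 - (n : ℝ)) / (n - 2)) := by
  have hderiv : ∀ t ∈ Ioo 0 s, HasDerivAt (fun t => -ballAverage u x t) (ballFlux u x t) t :=
    fun t ht =>
      (hasDerivAt_ballAverage_neg_ballFlux hu ht.1 (ht.2.trans hs)).neg.congr_deriv (neg_neg _)
  have hcont := (continuousOn_ballAverage hu hs).neg
  have hpos : ∀ t ∈ Ioo 0 s, 0 ≤ ballFlux u x t := fun t ht =>
    ballFlux_nonneg ht.1 fun z hz => hf0 z (ball_subset_ball ht.2.le hz)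
  have hint : IntegrableOn (ballFlux u x) (Ioc 0 s) :=
    intervalIntegral.integrableOn_deriv_of_nonneg hcont hderiv hpos
  have hftc := intervalIntegral.integral_eq_sub_of_hasDerivAt_of_le hs0.le hcont hderiv
    ((intervalIntegrable_iff_integrableOn_Ioc_of_le hs0.le).2 hint)
  rw [intervalIntegral.integral_of_le hs0.le, integral_Ioc_eq_integral_Ioo] at hftc
  have heq : ballAverage u x 0 = ballAverage u x s + ∫ t in Ioo 0 s, ballFlux u x t := by
    rw [hftc]; simp
  rw [heq]
  refine ENNReal.ofReal_add_le.trans (add_le_add le_rfl ?_)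
  rw [ofReal_integral_eq_lintegral_ofReal (hint.mono_set Ioo_subset_Ioc_self)
    ((ae_restrict_iff' measurableSet_Ioo).2 (ae_of_all _ hpos))]
  have hfm : AEMeasurable (fun z => -lap u z) (volume.restrict (ball x s)) :=
    (integrableOn_ball_neg_lap hu hs).aestronglyMeasurable.aemeasurable
  calc ∫⁻ t in Ioo 0 s, ENNReal.ofReal (ballFlux u x t)
      ≤ ∫⁻ t in Ioo 0 s, ∫⁻ z in ball x s, ENNReal.ofReal (-lap u z) *
          (Ioi ‖z - x‖).indicator (fun t => ENNReal.ofReal (t ^ (1 - (n : ℝ)))) t := by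
        refine setLIntegral_mono' measurableSet_Ioo fun t ht => ?_
        have hsub : ball x t ⊆ ball x s := ball_subset_ball ht.2.le
        have h1 := ballFlux_le hu ht.1 (ht.2.trans hs) fun z hz => hf0 z (hsub hz)
        refine (ENNReal.ofReal_le_ofReal h1).trans ?_
        rw [ENNReal.ofReal_mul (Real.rpow_nonneg ht.1.le _),
          ofReal_integral_eq_lintegral_ofReal ((integrableOn_ball_neg_lap hu hs).mono_set hsub)
            ((ae_restrict_iff' measurableSet_ball).2 (ae_of_all _ fun z hz => hf0 z (hsub hz))),
          ← lintegral_const_mul' _ _ ENNReal.ofReal_ne_top]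
        refine (setLIntegral_mono' measurableSet_ball fun z hz => ?_).trans
          (lintegral_mono_set hsub)
        have hz' : t ∈ Ioi ‖z - x‖ := by simpa [dist_eq_norm] using hz
        rw [indicator_of_mem hz', mul_comm]
    _ = ∫⁻ z in ball x s, ∫⁻ t in Ioo 0 s, ENNReal.ofReal (-lap u z) *
          (Ioi ‖z - x‖).indicator (fun t => ENNReal.ofReal (t ^ (1 - (n : ℝ)))) t := by
        refine lintegral_lintegral_swap ?_
        refine (hfm.ennreal_ofReal.comp_quasiMeasurePreserving
          Measure.quasiMeasurePreserving_snd).mul ?_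
        have hS : MeasurableSet {p : ℝ × Euc n | ‖p.2 - x‖ < p.1} :=
          (isOpen_lt (by fun_prop) (by fun_prop)).measurableSet
        have hM : Measurable ({p : ℝ × Euc n | ‖p.2 - x‖ < p.1}.indicator
          fun p => ENNReal.ofReal (p.1 ^ (1 - (n : ℝ)))) :=
          (measurable_fst.pow_const _).ennreal_ofReal.indicator hS
        exact hM.aemeasurable
    _ ≤ _ := by
        refine setLIntegral_mono_ae' measurableSet_ball ?_
        have hne : ∀ᵐ z : Euc n, z ≠ x := by
          have : Nonempty (Fin n) := ⟨⟨0, by omega⟩⟩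
          exact Measure.ae_ne volume x
        filter_upwards [hne] with z hz _
        rw [lintegral_const_mul' _ _ ENNReal.ofReal_ne_top]
        gcongr
        exact lintegral_rpow_Ioo_le hn (norm_pos_iff.2 (sub_ne_zero.2 hz)) s

lemma exists_setIntegral_ball_le {n : ℕ} (hn : 3 ≤ n) {u : Euc n → ℝ} (hu0 : ∀ x, 0 ≤ u x)
    (hu : ContDiffOn ℝ 2 u {0}ᶜ) (hsup : ∀ x ∈ ball (0 : Euc n) 2 \ {0}, 0 ≤ -lap u x) :
    ∃ C ≥ 0, ∀ x : Euc n, 0 < ‖x‖ → ‖x‖ < 1 / 2 → ∫ y in ball x (‖x‖ / 2), u y ≤ C * ‖x‖ ^ 2 := by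
  obtain ⟨C, hC, hb⟩ := exists_annulus_bound hn hu0 hu hsup
  refine ⟨C, hC, fun x hx0 hx => ?_⟩
  have h1 := (hb (‖x‖ / 2) (by linarith) (by linarith)).2
  have h2 : ∫ y in ball x (‖x‖ / 2), u y ≤
      ∫ y in {y | ‖x‖ / 2 ≤ ‖y‖ ∧ ‖y‖ ≤ 4 * (‖x‖ / 2) ∧ ‖y‖ < 1}, u y := by
    refine setIntegral_mono_set (integrableOn_of_continuousOn_compl_zero hu.continuousOn
      (half_pos hx0) (R := 1) fun y hy => ⟨hy.1, hy.2.2.le⟩) (ae_of_all _ hu0)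
      (LE.le.eventuallyLE fun y hy => ?_)
    rw [mem_ball, dist_eq_norm] at hy
    have h3 := norm_sub_norm_le y x
    have h4 := norm_sub_norm_le x y
    rw [norm_sub_rev] at h4
    exact ⟨by linarith, by linarith, by linarith⟩
  refine (h2.trans h1).trans ?_
  gcongr
  linarith

lemma exists_potential_bound {n : ℕ} (hn : 3 ≤ n) {u : Euc n → ℝ} (hu0 : ∀ x, 0 ≤ u x)
    (hu : ContDiffOn ℝ 2 u {0}ᶜ) (hsup : ∀ x ∈ ball (0 : Euc n) 2 \ {0}, 0 ≤ -lap u x) :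
    ∃ C ≥ 0, ∀ x : Euc n, 0 < ‖x‖ → ‖x‖ < 1 / 2 →
      ENNReal.ofReal ((∫ y : Euc n, ballWeight y) * u x) ≤
        ENNReal.ofReal (C * ‖x‖ ^ (2 - (n : ℝ))) +
        ∫⁻ z in ball (0 : Euc n) 1, ENNReal.ofReal (-lap u z) *
          ENNReal.ofReal (‖z - x‖ ^ (2 - (n : ℝ)) / (n - 2)) := by
  obtain ⟨C, hC, hb⟩ := exists_setIntegral_ball_le hn hu0 hu hsup
  refine ⟨4 * ((1 / 2) ^ (-(n : ℝ)) * C), by positivity, fun x hx0 hx => ?_⟩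
  have hs0 : 0 < ‖x‖ / 2 := half_pos hx0
  have hs : ‖x‖ / 2 < ‖x‖ := half_lt_self hx0
  have hsub : ball x (‖x‖ / 2) ⊆ ball 0 1 := fun z hz => by
    rw [mem_ball, dist_eq_norm] at hz
    have h3 := norm_sub_norm_le z x
    rw [mem_ball_zero_iff]
    linarith
  rw [← ballAverage_zero]
  refine (ofReal_ballAverage_zero_le hn hu hs0 hs fun z hz => hsup z
    ⟨ball_subset_ball one_le_two (hsub hz), ball_subset_compl_zero hs
      (ball_subset_closedBall hz)⟩).trans (add_le_add (ENNReal.ofReal_le_ofReal ?_)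
      (lintegral_mono_set hsub))
  refine (ballAverage_le hu hu0 hs0 hs).trans ?_
  rw [mul_assoc]
  refine mul_le_mul_of_nonneg_left ?_ (by norm_num)
  refine (mul_le_mul_of_nonneg_left (hb x hx0 hx) (by positivity)).trans (le_of_eq ?_)
  rw [div_eq_mul_one_div, Real.mul_rpow hx0.le (by norm_num),
    show (2 : ℝ) - n = 2 + -n by ring, Real.rpow_add hx0, Real.rpow_two]
  ring

lemma setLIntegral_norm_rpow_lt_top {n : ℕ} (hn : 1 ≤ n) {a : ℝ} (ha : a < n) (R : ℝ) :
    ∫⁻ w in ball (0 : Euc n) R, ENNReal.ofReal (‖w‖ ^ (-a)) < ⊤ := by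
  refine Integrable.lintegral_lt_top ?_
  refine integrableOn_ball_of_norm_le_rpow (C := 1) (α := a) (by simpa using hn) (by simpa using ha)
    (ae_of_all _ fun w => ?_) (measurable_norm.pow_const _).aestronglyMeasurable
  rw [Real.norm_of_nonneg (by positivity), one_mul]

/-- Jensen inequality for convolution-type integrals. -/
lemma lintegral_mul_rpow_le {X : Type*} [MeasurableSpace X] {μ : Measure X} {g K : X → ENNReal}
    (hg : AEMeasurable g μ) (hK : Measurable K) {q : ℝ} (hq : 1 < q) :
    (∫⁻ z, g z * K z ∂μ) ^ q ≤ (∫⁻ z, g z ∂μ) ^ (q - 1) * ∫⁻ z, g z * K z ^ q ∂μ := by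
  have hq0 : 0 < q := by linarith
  have hpq := (Real.HolderConjugate.conjExponent hq).symm
  have h := ENNReal.lintegral_mul_le_Lp_mul_Lq (μ.withDensity g) hpq (f := 1) (g := K)
    aemeasurable_one hK.aemeasurable
  rw [one_mul, lintegral_withDensity_eq_lintegral_mul₀ hg hK.aemeasurable,
    lintegral_withDensity_eq_lintegral_mul₀ hg (hK.pow_const q).aemeasurable] at h
  simp only [Pi.one_apply, ENNReal.one_rpow, lintegral_one, withDensity_apply _ MeasurableSet.univ,
    Measure.restrict_univ, Pi.mul_apply] at h
  refine (ENNReal.rpow_le_rpow h hq0.le).trans (le_of_eq ?_)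
  rw [ENNReal.mul_rpow_of_nonneg _ _ hq0.le, ← ENNReal.rpow_mul, ← ENNReal.rpow_mul,
    one_div_mul_cancel hq0.ne', ENNReal.rpow_one]
  congr 2
  rw [Real.conjExponent]
  have : q - 1 ≠ 0 := by linarith
  field_simp

lemma setLIntegral_rpow_lt_top {n : ℕ} (hn : 3 ≤ n) {u : Euc n → ℝ} (hu0 : ∀ x, 0 ≤ u x)
    (hu : ContDiffOn ℝ 2 u {0}ᶜ) (hsup : ∀ x ∈ ball (0 : Euc n) 2 \ {0}, 0 ≤ -lap u x)
    {q : ℝ} (hq1 : 1 < q) (hq : q < n / (n - 2)) :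
    ∫⁻ x in ball (0 : Euc n) (1 / 2), ENNReal.ofReal (u x) ^ q < ⊤ := by
  have hn' : (0 : ℝ) < n - 2 := by
    have : (3 : ℝ) ≤ n := by exact_mod_cast hn
    linarith
  have hq0 : 0 < q := by linarith
  have : Nonempty (Fin n) := ⟨⟨0, by omega⟩⟩
  obtain ⟨C, hC, hb⟩ := exists_potential_bound hn hu0 hu hsup
  set c := ∫ y : Euc n, ballWeight y with hc
  have hc0 : 0 < c := integral_ballWeight_pos n
  set g : Euc n → ENNReal := fun z => ENNReal.ofReal (-lap u z) with hgdef
  set k : Euc n → ENNReal := fun w => ENNReal.ofReal (‖w‖ ^ (2 - (n : ℝ)) / (n - 2)) with hk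
  have hkm : Measurable k := by fun_prop
  have hfi := integrableOn_neg_lap hn hu0 hu hsup
  have hg : AEMeasurable g (volume.restrict (ball 0 1)) :=
    hfi.aestronglyMeasurable.aemeasurable.ennreal_ofReal
  have hgt : ∫⁻ z in ball (0 : Euc n) 1, g z < ⊤ := hfi.lintegral_lt_top
  have hpow : ∀ (A : ℝ), 0 ≤ A → ∀ w : Euc n, ENNReal.ofReal (A * ‖w‖ ^ (2 - (n : ℝ))) ^ q =
      ENNReal.ofReal (A ^ q) * ENNReal.ofReal (‖w‖ ^ (-((n - 2) * q))) := by
    intro A hA w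
    rw [ENNReal.ofReal_rpow_of_nonneg (by positivity) hq0.le,
      Real.mul_rpow hA (by positivity), ← Real.rpow_mul (norm_nonneg w),
      ENNReal.ofReal_mul (by positivity)]
    congr 3
    ring
  have hlt : (n - 2) * q < n := by
    rw [lt_div_iff₀ hn'] at hq
    linarith
  have hkq : ∀ R : ℝ, ∀ A : ℝ, 0 ≤ A →
      ∫⁻ w in ball (0 : Euc n) R, ENNReal.ofReal (A * ‖w‖ ^ (2 - (n : ℝ))) ^ q < ⊤ := by
    intro R A hA
    simp_rw [hpow A hA]
    rw [lintegral_const_mul' _ _ ENNReal.ofReal_ne_top]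
    exact ENNReal.mul_lt_top ENNReal.ofReal_lt_top
      (setLIntegral_norm_rpow_lt_top (by omega) hlt R)
  have hk2 : ∫⁻ w in ball (0 : Euc n) 2, k w ^ q < ⊤ := by
    have := hkq 2 (1 / (n - 2)) (by positivity)
    simpa only [hk, div_mul_eq_mul_div, one_mul] using this
  have hP : ∫⁻ x in ball (0 : Euc n) (1 / 2),
      (∫⁻ z in ball (0 : Euc n) 1, g z * k (z - x)) ^ q < ⊤ := by
    calc ∫⁻ x in ball (0 : Euc n) (1 / 2), (∫⁻ z in ball (0 : Euc n) 1, g z * k (z - x)) ^ q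
        ≤ ∫⁻ x in ball (0 : Euc n) (1 / 2), (∫⁻ z in ball (0 : Euc n) 1, g z) ^ (q - 1) *
            ∫⁻ z in ball (0 : Euc n) 1, g z * k (z - x) ^ q :=
          lintegral_mono fun x => lintegral_mul_rpow_le hg (by fun_prop) hq1
      _ = (∫⁻ z in ball (0 : Euc n) 1, g z) ^ (q - 1) * ∫⁻ x in ball (0 : Euc n) (1 / 2),
            ∫⁻ z in ball (0 : Euc n) 1, g z * k (z - x) ^ q :=
          lintegral_const_mul' _ _ (ENNReal.rpow_ne_top_of_nonneg (by linarith) hgt.ne)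
      _ = (∫⁻ z in ball (0 : Euc n) 1, g z) ^ (q - 1) * ∫⁻ z in ball (0 : Euc n) 1,
            ∫⁻ x in ball (0 : Euc n) (1 / 2), g z * k (z - x) ^ q := by
          rw [lintegral_lintegral_swap]
          refine (hg.comp_quasiMeasurePreserving Measure.quasiMeasurePreserving_snd).mul ?_
          exact (((hkm.comp (measurable_snd.sub measurable_fst)).pow_const q)).aemeasurable
      _ ≤ (∫⁻ z in ball (0 : Euc n) 1, g z) ^ (q - 1) * ∫⁻ z in ball (0 : Euc n) 1,
            g z * ∫⁻ w in ball (0 : Euc n) 2, k w ^ q := by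
          refine mul_le_mul_right (setLIntegral_mono' measurableSet_ball fun z hz => ?_) _
          rw [lintegral_const_mul' _ _ ENNReal.ofReal_ne_top]
          refine mul_le_mul_right ?_ _
          rw [← lintegral_indicator measurableSet_ball, ← lintegral_indicator measurableSet_ball,
            ← lintegral_sub_left_eq_self (μ := volume)
              ((ball (0 : Euc n) 2).indicator fun w => k w ^ q) z]
          refine lintegral_mono fun x => ?_
          by_cases hx : x ∈ ball (0 : Euc n) (1 / 2)
          · rw [indicator_of_mem hx, indicator_of_mem]
            rw [mem_ball_zero_iff] at hx hz ⊢
            linarith [norm_sub_le z x]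
          · rw [indicator_of_notMem hx]
            exact zero_le
      _ < ⊤ := by
          rw [lintegral_mul_const' _ _ hk2.ne]
          exact ENNReal.mul_lt_top (ENNReal.rpow_lt_top_of_nonneg (by linarith) hgt.ne)
            (ENNReal.mul_lt_top hgt hk2)
  have hmain : ∫⁻ x in ball (0 : Euc n) (1 / 2), ENNReal.ofReal (c * u x) ^ q < ⊤ := by
    refine lt_of_le_of_lt (setLIntegral_mono_ae' (g := fun x => 2 ^ (q - 1) *
      (ENNReal.ofReal (C * ‖x‖ ^ (2 - (n : ℝ))) ^ q +
        (∫⁻ z in ball (0 : Euc n) 1, g z * k (z - x)) ^ q)) measurableSet_ball ?_) ?_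
    · filter_upwards [Measure.ae_ne volume (0 : Euc n)] with x hx hxb
      refine (ENNReal.rpow_le_rpow (hb x (norm_pos_iff.2 hx) (by simpa using hxb)) hq0.le).trans ?_
      exact ENNReal.rpow_add_le_mul_rpow_add_rpow _ _ hq1.le
    · have h2 : (2 : ENNReal) ^ (q - 1) ≠ ⊤ :=
        ENNReal.rpow_ne_top_of_nonneg (by linarith) ENNReal.ofNat_ne_top
      rw [lintegral_const_mul' _ _ h2, lintegral_add_left (by fun_prop)]
      exact ENNReal.mul_lt_top h2.lt_top (ENNReal.add_lt_top.2 ⟨hkq _ C hC, hP⟩)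
  have hsplit : ∀ x, ENNReal.ofReal (c * u x) ^ q =
      ENNReal.ofReal c ^ q * ENNReal.ofReal (u x) ^ q := fun x => by
    rw [ENNReal.ofReal_mul hc0.le, ENNReal.mul_rpow_of_nonneg _ _ hq0.le]
  simp_rw [hsplit] at hmain
  rw [lintegral_const_mul' _ _ (ENNReal.rpow_ne_top_of_nonneg hq0.le ENNReal.ofReal_ne_top)]
    at hmain
  refine ENNReal.lt_top_of_mul_ne_top_right hmain.ne ?_
  simp [hc0, ENNReal.rpow_eq_zero_iff]

lemma integrableOn_rpow {n : ℕ} (hn : 3 ≤ n) {u : Euc n → ℝ} (hu0 : ∀ x, 0 ≤ u x)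
    (hu : ContDiffOn ℝ 2 u {0}ᶜ) (hsup : ∀ x ∈ ball (0 : Euc n) 2 \ {0}, 0 ≤ -lap u x)
    {q : ℝ} (hq1 : 1 < q) (hq : q < n / (n - 2)) :
    IntegrableOn (fun x => u x ^ q) (ball (0 : Euc n) (1 / 2)) := by
  have : Nonempty (Fin n) := ⟨⟨0, by omega⟩⟩
  have hum : AEStronglyMeasurable u volume := by
    have := hu.continuousOn.aestronglyMeasurable (μ := volume) (measurableSet_singleton _).compl
    rwa [restrict_compl_singleton] at this
  refine ⟨(hum.aemeasurable.pow_const q).aestronglyMeasurable.restrict, ?_⟩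
  rw [hasFiniteIntegral_iff_ofReal (ae_of_all _ fun x => Real.rpow_nonneg (hu0 x) q)]
  refine lt_of_eq_of_lt ?_ (setLIntegral_rpow_lt_top hn hu0 hu hsup hq1 hq)
  exact lintegral_congr fun x =>
    (ENNReal.ofReal_rpow_of_nonneg (hu0 x) (by linarith)).symm

/-- The Riesz potential of `u ^ lam` is bounded near the origin. -/
lemma exists_riesz_bound {n : ℕ} (hn : 3 ≤ n) {α lam : ℝ} (hα0 : 0 < α) (hαn : α < n)
    (hlam0 : 0 < lam) (hlam1 : lam < ((n : ℝ) - α) / ((n : ℝ) - 2))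
    {u : Euc n → ℝ} (hu0 : ∀ x, 0 ≤ u x) (hu : ContDiffOn ℝ 2 u {0}ᶜ)
    (hui : Integrable fun y => u y ^ lam)
    (hsup : ∀ x ∈ ball (0 : Euc n) 2 \ {0}, 0 ≤ -lap u x) :
    ∃ K ≥ 0, ∀ x ∈ ball (0 : Euc n) (1 / 4), ∫ y, ‖x - y‖ ^ (-α) * u y ^ lam ≤ K := by
  have hn' : (0 : ℝ) < n - 2 := by
    have : (3 : ℝ) ≤ n := by exact_mod_cast hn
    linarith
  have hnα : 0 < n - α := by linarith
  obtain ⟨s, hs1, hs2⟩ : ∃ s, max 1 (lam * n / (n - α)) < s ∧ s < n / (n - 2) := by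
    refine exists_between (max_lt ?_ ?_)
    · rw [one_lt_div hn']; linarith
    · rw [lt_div_iff₀ hn'] at hlam1
      rw [div_lt_div_iff₀ hnα hn']
      nlinarith
  rw [max_lt_iff, div_lt_iff₀ hnα] at hs1
  obtain ⟨hs1, hs3⟩ := hs1
  set p := s / lam with hp
  have hp' : n < p * (n - α) := by
    rw [hp, div_mul_eq_mul_div, lt_div_iff₀ hlam0]; linarith
  have hp1 : 1 < p := by
    by_contra h
    have := mul_le_mul_of_nonneg_right (not_lt.1 h) hnα.le
    linarith
  have hpq := (Real.HolderConjugate.conjExponent hp1)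
  set r := Real.conjExponent p with hr
  have hr1 : 1 < r := hpq.symm.lt
  have hαr : α * r < n := by
    rw [hr, Real.conjExponent, mul_div_assoc', div_lt_iff₀ (by linarith)]
    linarith
  set G1 : Euc n → ℝ := (ball 0 (1 / 2)).indicator fun y => u y ^ s
  set G2 : Euc n → ℝ := (ball 0 1).indicator fun w => ‖w‖ ^ (-(α * r))
  have hG1 : Integrable G1 :=
    (integrableOn_rpow hn hu0 hu hsup hs1 hs2).integrable_indicator measurableSet_ball
  have hG2 : Integrable G2 := by
    refine IntegrableOn.integrable_indicator ?_ measurableSet_ball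
    refine integrableOn_ball_of_norm_le_rpow (C := 1) (α := α * r)
      (by simpa using (by omega : 1 ≤ n)) (by simpa using hαr)
      (ae_of_all _ fun w => ?_) (measurable_norm.pow_const _).aestronglyMeasurable
    rw [Real.norm_of_nonneg (by positivity), one_mul]
  have hG10 : ∀ y, 0 ≤ G1 y := fun y =>
    indicator_nonneg (fun z _ => Real.rpow_nonneg (hu0 z) s) y
  have hG20 : ∀ y, 0 ≤ G2 y := fun y => indicator_nonneg (fun z _ => by positivity) y
  refine ⟨(∫ y, G1 y) + (∫ y, G2 y) + 4 ^ α * ∫ y, u y ^ lam, ?_, fun x hx => ?_⟩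
  · have h1 : 0 ≤ ∫ y, G1 y := integral_nonneg fun y => hG10 y
    have h2 : 0 ≤ ∫ y, G2 y := integral_nonneg fun y => hG20 y
    have h3 : 0 ≤ ∫ y, u y ^ lam := integral_nonneg fun y => Real.rpow_nonneg (hu0 y) lam
    positivity
  have hG12 : Integrable fun y => G1 y + G2 (x - y) := hG1.add (hG2.comp_sub_left x)
  rw [← integral_sub_left_eq_self G2 volume x, ← integral_const_mul,
    ← integral_add hG1 (hG2.comp_sub_left x), ← integral_add hG12 (hui.const_mul _)]
  refine integral_mono_of_nonneg (ae_of_all _ fun y => ?_)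
    (hG12.add (hui.const_mul _)) (ae_of_all _ fun y => ?_)
  · exact mul_nonneg (by positivity) (Real.rpow_nonneg (hu0 y) _)
  simp only
  have hul : 0 ≤ u y ^ lam := Real.rpow_nonneg (hu0 y) _
  rw [mem_ball_zero_iff] at hx
  by_cases hy : y ∈ ball (0 : Euc n) (1 / 2)
  · have h1 : G1 y = u y ^ s := indicator_of_mem hy _
    have h2 : G2 (x - y) = ‖x - y‖ ^ (-(α * r)) := by
      refine indicator_of_mem ?_ _
      rw [mem_ball_zero_iff] at hy ⊢
      linarith [norm_sub_le x y]
    have hy2 := Real.young_inequality_of_nonneg hul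
      (Real.rpow_nonneg (norm_nonneg (x - y)) (-α)) hpq
    rw [← Real.rpow_mul (hu0 y), ← Real.rpow_mul (norm_nonneg _), hp,
      mul_div_cancel₀ _ hlam0.ne', ← hp, neg_mul] at hy2
    rw [h1, h2]
    have h3 : u y ^ s / p ≤ u y ^ s := div_le_self (Real.rpow_nonneg (hu0 y) s) hp1.le
    have h4 : ‖x - y‖ ^ (-(α * r)) / r ≤ ‖x - y‖ ^ (-(α * r)) :=
      div_le_self (by positivity) hr1.le
    have h5 : 0 ≤ (4 : ℝ) ^ α * u y ^ lam := by positivity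
    linarith
  · have h6 : 1 / 4 ≤ ‖x - y‖ := by
      rw [mem_ball_zero_iff, not_lt] at hy
      have := norm_sub_norm_le y x
      rw [norm_sub_rev] at this
      linarith
    have h7 : ‖x - y‖ ^ (-α) ≤ 4 ^ α := by
      refine (Real.rpow_le_rpow_of_nonpos (by norm_num) h6 (by linarith)).trans (le_of_eq ?_)
      rw [one_div, Real.inv_rpow (by norm_num), Real.rpow_neg (by norm_num), inv_inv]
    have := mul_le_mul_of_nonneg_right h7 hul
    linarith [hG10 y, hG20 (x - y)]

/-- Doubling: a point near which `w` is comparable to its value, found by maximizing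
`(r - dist y x) ^ n * w y`. -/
lemma exists_doubling_point {n : ℕ} (hn : n ≠ 0) {w : Euc n → ℝ} {x : Euc n} {r : ℝ} (hr : 0 < r)
    (hw : ContinuousOn w (closedBall x r)) (hw0 : ∀ y, 0 < w y) :
    ∃ x₀, 0 < r - dist x₀ x ∧ r ^ n * w x ≤ (r - dist x₀ x) ^ n * w x₀ ∧
      ∀ z ∈ ball x₀ ((r - dist x₀ x) / 2), w z ≤ 2 ^ n * w x₀ := by
  obtain ⟨x₀, hx₀, hmax⟩ := (isCompact_closedBall x r).exists_isMaxOn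
    ⟨x, mem_closedBall_self hr.le⟩
    (f := fun y => (r - dist y x) ^ n * w y) (ContinuousOn.mul (by fun_prop) hw)
  have h1 : r ^ n * w x ≤ (r - dist x₀ x) ^ n * w x₀ := by
    simpa using hmax (mem_closedBall_self hr.le)
  have hd : 0 < r - dist x₀ x := by
    refine lt_of_le_of_ne (sub_nonneg.2 hx₀) fun h => ?_
    rw [← h, zero_pow hn, zero_mul] at h1
    have := mul_pos (pow_pos hr n) (hw0 x)
    linarith
  refine ⟨x₀, hd, h1, fun z hz => ?_⟩
  rw [mem_ball] at hz
  have hzx : (r - dist x₀ x) / 2 ≤ r - dist z x := by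
    linarith [dist_triangle z x₀ x]
  have h2 : (r - dist z x) ^ n * w z ≤ (r - dist x₀ x) ^ n * w x₀ :=
    hmax (by rw [mem_closedBall]; linarith)
  have h3 : ((r - dist x₀ x) / 2) ^ n * w z ≤ (r - dist x₀ x) ^ n * w x₀ :=
    (mul_le_mul_of_nonneg_right (pow_le_pow_left₀ (by linarith) hzx n) (hw0 z).le).trans h2
  rw [div_pow, div_mul_eq_mul_div, div_le_iff₀ (by positivity)] at h3
  refine le_of_mul_le_mul_left ?_ (pow_pos hd n)
  linarith

lemma exists_setIntegral_ball_lt {n : ℕ} (hn : n ≠ 0) {f : Euc n → ℝ}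
    (hf : IntegrableOn f (ball 0 1)) {η : ℝ} (hη : 0 < η) :
    ∃ δ > 0, δ ≤ 1 ∧ ∫ y in ball (0 : Euc n) δ, f y < η := by
  have : Nonempty (Fin n) := ⟨⟨0, by omega⟩⟩
  set S : ℕ → Set (Euc n) := fun k => ball 0 (1 / ((k : ℝ) + 1)) with hS
  have hanti : Antitone S := fun i j hij => ball_subset_ball (Nat.one_div_le_one_div hij)
  have hlim := tendsto_setIntegral_of_antitone (μ := volume) (f := f) (s := S)
    (fun _ => measurableSet_ball) hanti ⟨0, by simpa [hS] using hf⟩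
  have hinter : ⋂ k, S k = {0} := by
    ext y
    simp only [hS, mem_iInter, mem_ball_zero_iff, mem_singleton_iff]
    refine ⟨fun h => ?_, fun h k => by rw [h, norm_zero]; positivity⟩
    exact norm_le_zero_iff.1 (ge_of_tendsto'
      (tendsto_one_div_add_atTop_nhds_zero_nat (𝕜 := ℝ)) fun k => (h k).le)
  rw [hinter, setIntegral_measure_zero _ (measure_singleton _)] at hlim
  obtain ⟨k, hk⟩ := (hlim.eventually_lt_const hη).exists
  refine ⟨1 / ((k : ℝ) + 1), by positivity, ?_, hk⟩
  rw [div_le_one (by positivity)]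
  linarith [(Nat.cast_nonneg k : (0 : ℝ) ≤ k)]

/-- A supersolution-type bound `-Δu ≤ K (1 + u) ^ (n / (n - 2))` near the origin forces `u` to grow
at most like the fundamental solution. -/
lemma exists_norm_rpow_bound {n : ℕ} (hn : 3 ≤ n) {u : Euc n → ℝ} (hu0 : ∀ x, 0 ≤ u x)
    (hu : ContDiffOn ℝ 2 u {0}ᶜ) (hsup : ∀ x ∈ ball (0 : Euc n) 2 \ {0}, 0 ≤ -lap u x)
    {K : ℝ} (hK0 : 0 ≤ K) (hK : ∀ x ∈ ball (0 : Euc n) (1 / 4) \ {0},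
      -lap u x ≤ K * (1 + u x) ^ ((n : ℝ) / (n - 2))) :
    ∃ C, ∃ δ > 0, ∀ x : Euc n, 0 < ‖x‖ → ‖x‖ < δ → u x ≤ C * ‖x‖ ^ (2 - (n : ℝ)) := by
  have hn' : (0 : ℝ) < n - 2 := by
    have : (3 : ℝ) ≤ n := by exact_mod_cast hn
    linarith
  have hn0 : (0 : ℝ) ≤ n := Nat.cast_nonneg n
  have : Nonempty (Fin n) := ⟨⟨0, by omega⟩⟩
  set p : ℝ := n / (n - 2) with hp
  have hp0 : 0 ≤ p := by positivity
  set c := ∫ y : Euc n, ballWeight y with hc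
  have hc0 : 0 < c := integral_ballWeight_pos n
  set V := volume.real (ball (0 : Euc n) 1) with hV
  have hV0 : 0 ≤ V := measureReal_nonneg
  obtain ⟨C, hC, hCb⟩ := exists_setIntegral_ball_le hn hu0 hu hsup
  obtain ⟨κ, hκ0, hκ⟩ : ∃ κ > 0, K * (2 ^ n) ^ p * V * κ ^ 2 ≤ c / 4 := by
    have hB : 0 ≤ K * (2 ^ n) ^ p * V := by positivity
    refine ⟨√(c / (4 * (K * (2 ^ n) ^ p * V + 1))), by positivity, ?_⟩
    rw [Real.sq_sqrt (by positivity), mul_div_assoc', div_le_div_iff₀ (by positivity) (by norm_num)]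
    nlinarith
  have hfi := integrableOn_neg_lap hn hu0 hu hsup
  obtain ⟨ρ, hρ0, hρ1, hρ⟩ := exists_setIntegral_ball_lt (by omega) hfi
    (η := c / 4 * (n - 2) / κ ^ (2 - (n : ℝ))) (by positivity)
  set η := c / 4 * (n - 2) / κ ^ (2 - (n : ℝ)) with hη
  have hηκ : η * κ ^ (2 - (n : ℝ)) / (n - 2) = c / 4 := by
    rw [hη]
    have : κ ^ (2 - (n : ℝ)) ≠ 0 := (Real.rpow_pos_of_pos hκ0 _).ne'
    field_simp
  refine ⟨2 ^ n * (2 + 8 * 2 ^ n * C / c), ρ / 8, by positivity, fun x hx0 hxρ => ?_⟩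
  set r := ‖x‖ / 2 with hr
  have hr0 : 0 < r := half_pos hx0
  have hrx : r < ‖x‖ := half_lt_self hx0
  obtain ⟨x₀, hd, hmain, hdbl⟩ := exists_doubling_point (n := n) (by omega)
    (w := fun y => 1 + u y) (x := x) hr0
    (continuousOn_const.add (hu.continuousOn.mono (ball_subset_compl_zero hrx)))
    fun y => by linarith [hu0 y]
  set d := r - dist x₀ x with hd_def
  have hdr : d ≤ r := by linarith [dist_nonneg (x := x₀) (y := x)]
  set w₀ := 1 + u x₀ with hw₀
  have hw1 : 1 ≤ w₀ := by linarith [hu0 x₀]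
  have hw0 : 0 < w₀ := by linarith
  have hsub : ball x₀ (d / 2) ⊆ ball x r := ball_subset_ball' (by linarith)
  have hnorm : ∀ z ∈ ball x r, 0 < ‖z‖ ∧ ‖z‖ < ρ / 4 := fun z hz => by
    rw [mem_ball, dist_eq_norm] at hz
    have h3 := norm_sub_norm_le z x
    have h4 := norm_sub_norm_le x z
    rw [norm_sub_rev] at h4
    exact ⟨by linarith, by linarith⟩
  have hmem : ∀ z ∈ ball x r, z ∈ ball (0 : Euc n) 2 \ {0} := fun z hz =>
    ⟨by rw [mem_ball_zero_iff]; linarith [(hnorm z hz).2], norm_pos_iff.1 (hnorm z hz).1⟩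
  have hx₀n : d / 2 < ‖x₀‖ := by
    have h4 := norm_sub_norm_le x x₀
    rw [← dist_eq_norm, dist_comm] at h4
    linarith
  set τ := κ * w₀ ^ (-1 / ((n : ℝ) - 2)) with hτ
  have hτ0 : 0 < τ := by positivity
  have hbound := ballAverage_zero_le hn hu (F := K * (2 ^ n * w₀) ^ p) (η := η) (half_pos hd) hx₀n
    hτ0 (fun z hz => hsup z (hmem z (hsub hz)))
    (fun z hz => by
      refine (hK z ⟨?_, (hmem z (hsub hz)).2⟩).trans ?_
      · rw [mem_ball_zero_iff]; linarith [(hnorm z (hsub hz)).2]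
      · exact mul_le_mul_of_nonneg_left (Real.rpow_le_rpow (by linarith [hu0 z])
          (hdbl z hz) hp0) hK0)
    (by
      refine le_trans (setIntegral_mono_set (hfi.mono_set (ball_subset_ball hρ1)) ?_
        (LE.le.eventuallyLE fun z hz => ?_)) hρ.le
      · refine (ae_restrict_iff' measurableSet_ball).2 ?_
        filter_upwards [Measure.ae_ne volume (0 : Euc n)] with z hz hzb
        exact hsup z ⟨ball_subset_ball (by linarith) hzb, hz⟩
      · have := (hnorm z (hsub hz)).2
        exact mem_ball_zero_iff.2 (by linarith))
  have hw_sq : w₀ ^ p * (w₀ ^ (-1 / ((n : ℝ) - 2))) ^ 2 = w₀ := by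
    rw [← Real.rpow_natCast, ← Real.rpow_mul hw0.le, ← Real.rpow_add hw0]
    convert Real.rpow_one w₀ using 2
    rw [hp]
    push_cast
    field_simp
    ring
  have h1 : K * (2 ^ n * w₀) ^ p * V * τ ^ 2 ≤ c / 4 * w₀ := by
    rw [Real.mul_rpow (by positivity) hw0.le, hτ, mul_pow]
    calc K * ((2 ^ n) ^ p * w₀ ^ p) * V * (κ ^ 2 * (w₀ ^ (-1 / ((n : ℝ) - 2))) ^ 2)
        = K * (2 ^ n) ^ p * V * κ ^ 2 * (w₀ ^ p * (w₀ ^ (-1 / ((n : ℝ) - 2))) ^ 2) := by ring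
      _ ≤ c / 4 * w₀ := by rw [hw_sq]; exact mul_le_mul_of_nonneg_right hκ hw0.le
  have h2 : η * τ ^ (2 - (n : ℝ)) / (n - 2) = c / 4 * w₀ := by
    rw [hτ, Real.mul_rpow hκ0.le (by positivity), ← Real.rpow_mul hw0.le,
      show -1 / ((n : ℝ) - 2) * (2 - n) = 1 by field_simp; ring, Real.rpow_one, ← hηκ]
    ring
  have h3 : ballAverage u x₀ (d / 2) ≤ 4 * ((d / 2) ^ (-(n : ℝ)) * (C * ‖x‖ ^ 2)) := by
    refine (ballAverage_le hu hu0 (half_pos hd) hx₀n).trans ?_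
    gcongr
    refine le_trans (setIntegral_mono_set ?_ (ae_of_all _ hu0) hsub.eventuallyLE)
      (hCb x hx0 (by linarith))
    exact ((hu.continuousOn.mono (ball_subset_compl_zero hrx)).integrableOn_compact
      (isCompact_closedBall x r)).mono_set ball_subset_closedBall
  rw [ballAverage_zero] at hbound
  rw [Real.rpow_neg (half_pos hd).le, Real.rpow_natCast] at h3
  have h4 : c * w₀ ≤ 2 * c + 8 * ((d / 2) ^ n)⁻¹ * (C * ‖x‖ ^ 2) := by
    have : c * u x₀ = c * w₀ - c := by rw [hw₀]; ring
    linarith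
  have hdn : d ^ n ≤ ‖x‖ ^ 2 :=
    (pow_le_pow_left₀ hd.le (by linarith) n).trans
      (pow_le_pow_of_le_one hx0.le (by linarith) (by omega))
  have h5 : d ^ n * w₀ ≤ (2 + 8 * 2 ^ n * C / c) * ‖x‖ ^ 2 := by
    have h6 := mul_le_mul_of_nonneg_left h4 (pow_pos hd n).le
    rw [div_pow, inv_div] at h6
    have h7 : d ^ n * (2 * c + 8 * (2 ^ n / d ^ n) * (C * ‖x‖ ^ 2)) =
        2 * c * d ^ n + 8 * 2 ^ n * C * ‖x‖ ^ 2 := by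
      have := (pow_pos hd n).ne'
      field_simp
    refine le_of_mul_le_mul_left ?_ hc0
    calc c * (d ^ n * w₀) = d ^ n * (c * w₀) := by ring
      _ ≤ 2 * c * d ^ n + 8 * 2 ^ n * C * ‖x‖ ^ 2 := h6.trans_eq h7
      _ ≤ 2 * c * ‖x‖ ^ 2 + 8 * 2 ^ n * C * ‖x‖ ^ 2 := by gcongr
      _ = c * ((2 + 8 * 2 ^ n * C / c) * ‖x‖ ^ 2) := by field_simp
  have h8 := hmain.trans h5
  rw [hr, div_pow, div_mul_eq_mul_div, div_le_iff₀ (by positivity)] at h8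
  have h9 : ‖x‖ ^ (2 - (n : ℝ)) = ‖x‖ ^ 2 / ‖x‖ ^ n := by
    rw [Real.rpow_sub hx0, Real.rpow_two, Real.rpow_natCast]
  rw [h9, mul_div_assoc', le_div_iff₀ (pow_pos hx0 n)]
  have := pow_pos hx0 n
  nlinarith

theorem stmt9 (n : ℕ) (hn : 3 ≤ n) (α lam sig : ℝ)
    (hα0 : 0 < α) (hαn : α < n)
    (hlam0 : 0 < lam) (hlam1 : lam < ((n : ℝ) - α) / ((n : ℝ) - 2))
    (hsig0 : 0 ≤ sig) (hsig1 : sig ≤ (n : ℝ) / ((n : ℝ) - 2))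
    (u : Euc n → ℝ) (hu : IsCPSolution n α lam sig u) :
    u =O[𝓝[≠] (0 : Euc n)] fun x => ‖x‖ ^ (2 - (n : ℝ)) := by
  obtain ⟨hu0, hu2, hui, hineq⟩ := hu
  have hsup : ∀ x ∈ ball (0 : Euc n) 2 \ {0}, 0 ≤ -lap u x := fun x hx => (hineq x hx).1
  obtain ⟨K, hK0, hK⟩ := exists_riesz_bound hn hα0 hαn hlam0 hlam1 hu0 hu2 hui hsup
  obtain ⟨C, δ, hδ, hC⟩ := exists_norm_rpow_bound hn hu0 hu2 hsup hK0 fun x hx => by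
    refine (hineq x ⟨ball_subset_ball (by norm_num) hx.1, hx.2⟩).2.trans ?_
    refine mul_le_mul (hK x hx.1) ?_ (Real.rpow_nonneg (hu0 x) _) hK0
    exact (Real.rpow_le_rpow (hu0 x) (by linarith) hsig0).trans
      (Real.rpow_le_rpow_of_exponent_le (by linarith [hu0 x]) hsig1)
  refine IsBigO.of_bound C ?_
  filter_upwards [self_mem_nhdsWithin, nhdsWithin_le_nhds (ball_mem_nhds (0 : Euc n) hδ)]
    with x hx hxδ
  rw [Real.norm_of_nonneg (hu0 x), Real.norm_of_nonneg (by positivity)]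
  exact hC x (norm_pos_iff.2 hx) (mem_ball_zero_iff.1 hxδ)
end

section
/- Suppose n ≥ 3, α ∈ (0,n), 0 < λ < (n−α)/(n−2), and σ > n/(n−2). Let φ : (0,1) → (0,∞) be a continuous function with φ(t) → ∞ as t → 0⁺. Then there exists a nonnegative solution u of the Choquard–Pekar inequality problem such that u(x) ≠ O(φ(|x|)) as x → 0. -/
open MeasureTheory Metric Filter Set Asymptotics Topology

/-- `u(x) ≠ O(φ(|x|))` as `x → 0`: there is a sequence `x_j → 0` with
`u(x_j)/φ(|x_j|) → ∞`. -/
def NotBigOAt (n : ℕ) (u : Euc n → ℝ) (φ : ℝ → ℝ) : Prop :=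
  ∃ x : ℕ → Euc n, (∀ j, x j ≠ 0) ∧ Tendsto x atTop (𝓝 0) ∧
    Tendsto (fun j => u (x j) / φ ‖x j‖) atTop atTop

/-- A smooth truncation: it vanishes on `(-∞, 1]` and is the identity on `[2, ∞)`. -/
noncomputable def truncation (t : ℝ) : ℝ := t * Real.smoothTransition (t - 1)

lemma contDiff_truncation : ContDiff ℝ 2 truncation :=
  contDiff_id.mul ((Real.smoothTransition.contDiff (n := 2)).comp (contDiff_id.sub contDiff_const))

lemma truncation_of_le_one {t : ℝ} (ht : t ≤ 1) : truncation t = 0 := by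
  simp [truncation, Real.smoothTransition.zero_of_nonpos (by linarith : t - 1 ≤ 0)]

lemma truncation_of_two_le {t : ℝ} (ht : 2 ≤ t) : truncation t = t := by
  simp [truncation, Real.smoothTransition.one_of_one_le (by linarith : 1 ≤ t - 1)]

lemma truncation_nonneg (t : ℝ) : 0 ≤ truncation t := by
  rcases le_total t 1 with h | h
  · rw [truncation_of_le_one h]
  · exact mul_nonneg (by linarith) (Real.smoothTransition.nonneg _)

lemma truncation_le {t : ℝ} (ht : 0 ≤ t) : truncation t ≤ t :=
  mul_le_of_le_one_right ht (Real.smoothTransition.le_one _)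

lemma sub_two_le_truncation (t : ℝ) : t - 2 ≤ truncation t := by
  rcases le_total t 2 with h | h
  · linarith [truncation_nonneg t]
  · rw [truncation_of_two_le h]; linarith

lemma monotone_truncation : Monotone truncation := by
  intro a b hab
  rcases le_total a 1 with h | h
  · rw [truncation_of_le_one h]; exact truncation_nonneg b
  · exact mul_le_mul hab (Real.smoothTransition.monotone (by linarith))
      (Real.smoothTransition.nonneg _) (by linarith)

lemma deriv_truncation_nonneg (t : ℝ) : 0 ≤ deriv truncation t :=
  monotone_truncation.deriv_nonneg

lemma deriv_truncation_of_lt_one {t : ℝ} (ht : t < 1) : deriv truncation t = 0 := by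
  have h : truncation =ᶠ[𝓝 t] fun _ => 0 := by
    filter_upwards [Iio_mem_nhds ht] with s hs using truncation_of_le_one (le_of_lt hs)
  rw [h.deriv_eq, deriv_const]

lemma deriv_truncation_of_two_lt {t : ℝ} (ht : 2 < t) : deriv truncation t = 1 := by
  have h : truncation =ᶠ[𝓝 t] id := by
    filter_upwards [Ioi_mem_nhds ht] with s hs using truncation_of_two_le (le_of_lt hs)
  rw [h.deriv_eq, deriv_id]

lemma deriv_deriv_truncation_of_lt_one {t : ℝ} (ht : t < 1) :
    deriv (deriv truncation) t = 0 := by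
  have h : deriv truncation =ᶠ[𝓝 t] fun _ => 0 := by
    filter_upwards [Iio_mem_nhds ht] with s hs using deriv_truncation_of_lt_one hs
  rw [h.deriv_eq, deriv_const]

lemma deriv_deriv_truncation_of_two_lt {t : ℝ} (ht : 2 < t) :
    deriv (deriv truncation) t = 0 := by
  have h : deriv truncation =ᶠ[𝓝 t] fun _ => 1 := by
    filter_upwards [Ioi_mem_nhds ht] with s hs using deriv_truncation_of_two_lt hs
  rw [h.deriv_eq, deriv_const]

lemma contDiff_deriv_truncation : ContDiff ℝ 1 (deriv truncation) :=
  ((contDiff_succ_iff_deriv (n := 1)).1 (by rw [one_add_one_eq_two]; exact contDiff_truncation)).2.2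

lemma exists_deriv_truncation_le :
    ∃ C, 0 ≤ C ∧ ∀ t, deriv truncation t ≤ C ∧ |deriv (deriv truncation) t| ≤ C := by
  obtain ⟨A, hA⟩ := (isCompact_Icc (a := (1 : ℝ)) (b := 2)).exists_bound_of_continuousOn
    contDiff_deriv_truncation.continuous.continuousOn
  obtain ⟨B, hB⟩ := (isCompact_Icc (a := (1 : ℝ)) (b := 2)).exists_bound_of_continuousOn
    (contDiff_deriv_truncation.continuous_deriv le_rfl).continuousOn
  simp only [Real.norm_eq_abs] at hA hB
  have hC : 0 ≤ max 1 (max A B) := le_max_of_le_left zero_le_one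
  refine ⟨max 1 (max A B), hC, fun t => ?_⟩
  rcases lt_or_ge t 1 with h1 | h1
  · simp [deriv_truncation_of_lt_one h1, deriv_deriv_truncation_of_lt_one h1]
  rcases lt_or_ge 2 t with h2 | h2
  · simp [deriv_truncation_of_two_lt h2, deriv_deriv_truncation_of_two_lt h2]
  · exact ⟨(le_abs_self _).trans ((hA t ⟨h1, h2⟩).trans (by simp)),
      (hB t ⟨h1, h2⟩).trans (by simp)⟩

lemma lap_comp_norm_sub_sq {n : ℕ} {G G' : ℝ → ℝ} {G'' : ℝ} {c x : Euc n}
    (h₁ : ∀ᶠ t in 𝓝 (‖x - c‖ ^ 2), HasDerivAt G (G' t) t)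
    (h₂ : HasDerivAt G' G'' (‖x - c‖ ^ 2)) :
    lap (fun y => G (‖y - c‖ ^ 2)) x = 4 * ‖x - c‖ ^ 2 * G'' + 2 * n * G' (‖x - c‖ ^ 2) := by
  have hsq (y : Euc n) : HasFDerivAt (fun y => ‖y - c‖ ^ 2) (2 • innerSL ℝ (y - c)) y := by
    simpa using ((hasFDerivAt_id y).sub_const c).norm_sq
  have hcont : ContinuousAt (fun y : Euc n => ‖y - c‖ ^ 2) x := (hsq x).continuousAt
  have hfd : fderiv ℝ (fun y => G (‖y - c‖ ^ 2)) =ᶠ[𝓝 x]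
      fun y => G' (‖y - c‖ ^ 2) • ((2 • innerSL ℝ (y - c) : Euc n →L[ℝ] ℝ)) := by
    filter_upwards [hcont.eventually h₁] with y hy
    exact (hy.comp_hasFDerivAt y (hsq y)).fderiv
  have hlin : HasFDerivAt (fun y : Euc n => (2 • innerSL ℝ (y - c) : Euc n →L[ℝ] ℝ))
      (2 • innerSL ℝ : Euc n →L[ℝ] Euc n →L[ℝ] ℝ) x := by
    have := (2 • innerSL ℝ : Euc n →L[ℝ] Euc n →L[ℝ] ℝ).hasFDerivAt.comp x
      ((hasFDerivAt_id x).sub_const c)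
    exact this
  have hsec : HasFDerivAt
      (fun y => G' (‖y - c‖ ^ 2) • ((2 • innerSL ℝ (y - c) : Euc n →L[ℝ] ℝ))) _ x :=
    (h₂.comp_hasFDerivAt x (hsq x)).smul hlin
  have key (i : Fin n) : iteratedFDeriv ℝ 2 (fun y => G (‖y - c‖ ^ 2)) x
      ![EuclideanSpace.single i 1, EuclideanSpace.single i 1]
      = 4 * G'' * (x - c) i ^ 2 + 2 * G' (‖x - c‖ ^ 2) := by
    rw [iteratedFDeriv_two_apply, hfd.fderiv_eq, hsec.fderiv]
    have hself : innerSL ℝ (EuclideanSpace.single i (1 : ℝ)) (EuclideanSpace.single i 1) = 1 := by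
      rw [innerSL_apply_apply]; simp
    simp [EuclideanSpace.inner_single_right, hself]
    ring
  have hn : ‖x - c‖ ^ 2 = ∑ i, (x - c) i ^ 2 := EuclideanSpace.real_norm_sq_eq (x - c)
  simp only [lap, key, Finset.sum_add_distrib, ← Finset.mul_sum, ← hn]
  simp
  ring

/-- The radial profile, in the variable `s = |x|²`, of a truncated and rescaled bubble
`(δ + |x|²)^(-k)` with `k = (n - 2) / 2`. It is supported in `s ≤ ρ²`. -/
noncomputable def bubble (k δ ρ s : ℝ) : ℝ :=
  ρ ^ 2 * truncation (ρ ^ (2 * k) * (δ + s) ^ (-k))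

section Bubble

variable {k δ ρ s : ℝ}

lemma bubble_nonneg (k δ ρ s : ℝ) : 0 ≤ bubble k δ ρ s :=
  mul_nonneg (sq_nonneg ρ) (truncation_nonneg _)

lemma bubble_eq_zero (hk : 0 < k) (hδ : 0 < δ) (hρ : 0 < ρ) (hs : ρ ^ 2 ≤ s) :
    bubble k δ ρ s = 0 := by
  have hS : 0 < δ + s := by nlinarith [sq_nonneg ρ]
  rw [bubble, truncation_of_le_one, mul_zero]
  rw [Real.rpow_neg hS.le, ← div_eq_mul_inv, div_le_one (by positivity), Real.rpow_mul hρ.le]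
  exact Real.rpow_le_rpow (by positivity) (by norm_cast; linarith) hk.le

lemma bubble_le (hk : 0 < k) (hδ : 0 < δ) (hρ : 0 < ρ) (hs : 0 < s) :
    bubble k δ ρ s ≤ ρ ^ 2 * ρ ^ (2 * k) * s ^ (-k) := by
  rw [bubble, mul_assoc]
  refine mul_le_mul_of_nonneg_left ((truncation_le (by positivity)).trans ?_) (by positivity)
  exact mul_le_mul_of_nonneg_left
    (Real.rpow_le_rpow_of_nonpos hs (by linarith) (by linarith)) (by positivity)

lemma le_bubble (hρ : 0 < ρ) (hρ1 : ρ ≤ 1) :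
    ρ ^ 2 * ρ ^ (2 * k) * (δ + s) ^ (-k) - 2 ≤ bubble k δ ρ s := by
  have h := mul_le_mul_of_nonneg_left
    (sub_two_le_truncation (ρ ^ (2 * k) * (δ + s) ^ (-k))) (sq_nonneg ρ)
  rw [bubble]
  nlinarith

lemma contDiffAt_bubble (hS : 0 < δ + s) : ContDiffAt ℝ 2 (bubble k δ ρ) s :=
  contDiffAt_const.mul (contDiff_truncation.contDiffAt.comp s (contDiffAt_const.mul
    ((contDiffAt_const.add contDiffAt_id).rpow_const_of_ne hS.ne')))

lemma lap_bubble {n : ℕ} (hkn : 2 * k + 2 = n) (hδ : 0 < δ) (c x : Euc n) :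
    -lap (fun y => bubble k δ ρ (‖y - c‖ ^ 2)) x =
      deriv truncation (ρ ^ (2 * k) * (δ + ‖x - c‖ ^ 2) ^ (-k)) * (2 * n * k) *
        (ρ ^ 2 * ρ ^ (2 * k) * (δ * (δ + ‖x - c‖ ^ 2) ^ (-k - 2))) -
      deriv (deriv truncation) (ρ ^ (2 * k) * (δ + ‖x - c‖ ^ 2) ^ (-k)) *
        (ρ ^ 2 * (4 * ‖x - c‖ ^ 2) * (ρ ^ (2 * k) * (k * (δ + ‖x - c‖ ^ 2) ^ (-k - 1))) ^ 2) := by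
  have hpow (p : ℝ) {t : ℝ} (ht : 0 < δ + t) :
      HasDerivAt (fun t => (δ + t) ^ p) (p * (δ + t) ^ (p - 1)) t := by
    simpa using ((hasDerivAt_id t).const_add δ).rpow_const (p := p) (Or.inl ht.ne')
  have hP {t : ℝ} (ht : 0 < δ + t) : HasDerivAt (fun t => ρ ^ (2 * k) * (δ + t) ^ (-k))
      (ρ ^ (2 * k) * (-k * (δ + t) ^ (-k - 1))) t := (hpow (-k) ht).const_mul _
  have hS : 0 < δ + ‖x - c‖ ^ 2 := by positivity
  have h₁ : ∀ᶠ t in 𝓝 (‖x - c‖ ^ 2), HasDerivAt (bubble k δ ρ)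
      (ρ ^ 2 * (deriv truncation (ρ ^ (2 * k) * (δ + t) ^ (-k)) *
        (ρ ^ (2 * k) * (-k * (δ + t) ^ (-k - 1))))) t := by
    have : ∀ᶠ t in 𝓝 (‖x - c‖ ^ 2), 0 < δ + t :=
      (by fun_prop : ContinuousAt (fun t => δ + t) (‖x - c‖ ^ 2)).eventually_const_lt hS
    filter_upwards [this] with t ht
    exact ((contDiff_truncation.differentiable (by norm_num) _).hasDerivAt.comp t (hP ht)).const_mul _
  have h₂ := (((contDiff_deriv_truncation.differentiable (by norm_num) _).hasDerivAt.comp _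
    (hP hS)).mul (((hpow (-k - 1) hS).const_mul (-k)).const_mul (ρ ^ (2 * k)))).const_mul (ρ ^ 2)
  rw [lap_comp_norm_sub_sq h₁ h₂, ← hkn]
  have e1 : (δ + ‖x - c‖ ^ 2) ^ (-k - 1) = (δ + ‖x - c‖ ^ 2) * (δ + ‖x - c‖ ^ 2) ^ (-k - 2) := by
    rw [mul_comm, ← Real.rpow_add_one hS.ne']; ring_nf
  have e2 : -k - 1 - 1 = -k - 2 := by ring
  simp only [Function.comp_apply, e2]
  rw [e1]
  ring

lemma abs_deriv_deriv_truncation_mul_le (hk : 1 / 2 ≤ k) (hδ : 0 < δ) (hρ : 0 < ρ) (hs : 0 ≤ s) :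
    |deriv (deriv truncation) (ρ ^ (2 * k) * (δ + s) ^ (-k))| *
      (ρ ^ 2 * (4 * s) * (ρ ^ (2 * k) * (k * (δ + s) ^ (-k - 1))) ^ 2) ≤
    |deriv (deriv truncation) (ρ ^ (2 * k) * (δ + s) ^ (-k))| * (64 * k ^ 2) := by
  have hS : 0 < δ + s := by positivity
  set P := ρ ^ (2 * k) * (δ + s) ^ (-k) with hP
  rcases lt_or_ge 2 P with h | h
  · simp [deriv_deriv_truncation_of_two_lt h]
  refine mul_le_mul_of_nonneg_left ?_ (abs_nonneg _)
  have hP0 : 0 < P := by positivity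
  have hlow : ρ ^ 2 / 4 ≤ δ + s := by
    by_contra! hlt
    have h1 : (ρ ^ 2 / 4) ^ (-k) < (δ + s) ^ (-k) := Real.rpow_lt_rpow_of_neg hS hlt (by linarith)
    have h2 : ρ ^ (2 * k) * (ρ ^ 2 / 4) ^ (-k) = 4 ^ k := by
      rw [Real.rpow_neg (by positivity), Real.div_rpow (by positivity) (by norm_num),
        ← Real.rpow_natCast ρ 2, ← Real.rpow_mul hρ.le]
      push_cast
      field_simp
    have h3 : (2 : ℝ) ≤ 4 ^ k := by
      calc (2 : ℝ) = 4 ^ (1 / 2 : ℝ) := by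
            rw [show (4 : ℝ) = 2 ^ (2 : ℝ) by norm_num, ← Real.rpow_mul (by norm_num)]; norm_num
        _ ≤ 4 ^ k := Real.rpow_le_rpow_of_exponent_le (by norm_num) hk
    have h4 := mul_lt_mul_of_pos_left h1 (Real.rpow_pos_of_pos hρ (2 * k))
    linarith
  have e1 : ρ ^ (2 * k) * (k * (δ + s) ^ (-k - 1)) = k * P / (δ + s) := by
    rw [hP, Real.rpow_sub_one hS.ne']; ring
  rw [e1, div_pow, ← mul_div_assoc, div_le_iff₀ (by positivity)]
  have h5 : ρ ^ 2 * s ≤ 4 * (δ + s) ^ 2 := by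
    nlinarith [mul_le_mul_of_nonneg_left hlow hs]
  have h6 : P ^ 2 ≤ 4 := by nlinarith
  calc ρ ^ 2 * (4 * s) * (k * P) ^ 2 = 4 * k ^ 2 * ((ρ ^ 2 * s) * P ^ 2) := by ring
    _ ≤ 4 * k ^ 2 * ((4 * (δ + s) ^ 2) * 4) := by gcongr
    _ = 64 * k ^ 2 * (δ + s) ^ 2 := by ring

lemma neg_lap_bubble_bounds {n : ℕ} {C : ℝ} (hk : 1 / 2 ≤ k) (hkn : 2 * k + 2 = n) (hδ : 0 < δ)
    (hρ : 0 < ρ) (hC : ∀ t, deriv truncation t ≤ C ∧ |deriv (deriv truncation) t| ≤ C)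
    (c x : Euc n) :
    -(C * (64 * k ^ 2)) ≤ -lap (fun y => bubble k δ ρ (‖y - c‖ ^ 2)) x ∧
    -lap (fun y => bubble k δ ρ (‖y - c‖ ^ 2)) x ≤ C * (64 * k ^ 2) + C * (2 * n * k) *
      (ρ ^ 2 * ρ ^ (2 * k) * (δ * (δ + ‖x - c‖ ^ 2) ^ (-k - 2))) := by
  have hk0 : 0 < k := by linarith
  rw [lap_bubble hkn hδ]
  have h := abs_deriv_deriv_truncation_mul_le hk hδ hρ (sq_nonneg ‖x - c‖)
  set P := ρ ^ (2 * k) * (δ + ‖x - c‖ ^ 2) ^ (-k)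
  set W := ρ ^ 2 * (4 * ‖x - c‖ ^ 2) * (ρ ^ (2 * k) * (k * (δ + ‖x - c‖ ^ 2) ^ (-k - 1))) ^ 2
  set Q := ρ ^ 2 * ρ ^ (2 * k) * (δ * (δ + ‖x - c‖ ^ 2) ^ (-k - 2))
  have hQ : 0 ≤ Q := by positivity
  have hW : 0 ≤ W := by positivity
  have h1 : |deriv (deriv truncation) P * W| ≤ C * (64 * k ^ 2) := by
    rw [abs_mul, abs_of_nonneg hW]
    exact h.trans (mul_le_mul_of_nonneg_right (hC P).2 (by positivity))
  have h2 : 0 ≤ deriv truncation P * (2 * n * k) * Q :=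
    mul_nonneg (mul_nonneg (deriv_truncation_nonneg P) (by positivity)) hQ
  have h3 : deriv truncation P * (2 * n * k) * Q ≤ C * (2 * n * k) * Q := by
    have := (hC P).1
    gcongr
  obtain ⟨h4, h5⟩ := abs_le.1 h1
  constructor <;> linarith

/-- The right-hand side `E * u ^ τ` dominates `-Δ` of a sufficiently concentrated bubble. -/
lemma bubble_source_le {q S τ D E : ℝ} (hq : 0 < q) (hδ : 0 < δ) (hS : δ ≤ S)
    (hD : 0 ≤ D) (hτ : k * τ ≤ k + 2)
    (h : D * δ ^ (k * τ - k - 1) ≤ E * q ^ (τ - 1)) :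
    D * (q * (δ * S ^ (-k - 2))) ≤ E * (q * S ^ (-k)) ^ τ := by
  have hS0 : 0 < S := hδ.trans_le hS
  have e1 : (q * S ^ (-k)) ^ τ = q * q ^ (τ - 1) * S ^ (-(k * τ)) := by
    rw [Real.mul_rpow hq.le (by positivity), ← Real.rpow_mul hS0.le, mul_comm q,
      ← Real.rpow_add_one hq.ne']
    ring_nf
  have e2 : S ^ (-(k * τ)) = S ^ (-k - 1) / S ^ (k * τ - k - 1) := by
    rw [← Real.rpow_sub hS0]; ring_nf
  have h1 : δ / S ≤ (δ / S) ^ (k * τ - k - 1) := by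
    simpa using Real.rpow_le_rpow_of_exponent_ge (by positivity : 0 < δ / S)
      ((div_le_one hS0).2 hS) (by linarith : k * τ - k - 1 ≤ 1)
  calc D * (q * (δ * S ^ (-k - 2))) = D * q * S ^ (-k - 1) * (δ / S) := by
        rw [show -k - 2 = -k - 1 - 1 by ring, Real.rpow_sub_one hS0.ne' (-k - 1)]; ring
    _ ≤ D * q * S ^ (-k - 1) * (δ / S) ^ (k * τ - k - 1) := by gcongr
    _ = (D * δ ^ (k * τ - k - 1)) * (q * S ^ (-(k * τ))) := by
        rw [Real.div_rpow hδ.le hS0.le, e2]; ring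
    _ ≤ (E * q ^ (τ - 1)) * (q * S ^ (-(k * τ))) := by gcongr
    _ = E * (q * S ^ (-k)) ^ τ := by rw [e1]; ring

end Bubble

lemma exists_concentration {k θ D E q N : ℝ} (hk : 0 < k) (hθ : 0 < θ) (hE : 0 < E) (hq : 0 < q) :
    ∃ δ > 0, D * δ ^ θ ≤ E ∧ N ≤ q * δ ^ (-k) := by
  have h1 : Tendsto (fun δ : ℝ => D * δ ^ θ) (𝓝[>] 0) (𝓝 0) := by
    have := ((Real.continuousAt_rpow_const 0 θ (Or.inr hθ.le)).tendsto.const_mul D)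
    simp only [Real.zero_rpow hθ.ne', mul_zero] at this
    exact this.mono_left nhdsWithin_le_nhds
  have h2 : Tendsto (fun δ : ℝ => q * δ ^ (-k)) (𝓝[>] 0) atTop :=
    (tendsto_rpow_neg_nhdsGT_zero (by linarith)).const_mul_atTop hq
  obtain ⟨δ, hδ, h3, h4⟩ := (eventually_mem_nhdsWithin.and
    ((h1.eventually (ge_mem_nhds hE)).and (h2.eventually_ge_atTop N))).exists
  exact ⟨δ, hδ, h3, h4⟩

section Integrability

lemma integrableOn_norm_rpow_ball {n : ℕ} (hn : 0 < n) {p R : ℝ} (hp : p < n) (hR : 0 < R) :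
    IntegrableOn (fun y : Euc n => ‖y‖ ^ (-p)) (ball 0 R) := by
  have : Nonempty (Fin n) := ⟨⟨0, hn⟩⟩
  rw [integrableOn_fun_norm_addHaar volume (f := fun t : ℝ => t ^ (-p))]
  refine IntegrableOn.congr_fun ((intervalIntegral.integrableOn_Ioo_rpow_iff hR).2
    (by linarith : -1 < (n : ℝ) - 1 - p)) (fun t ht => ?_) measurableSet_Ioo
  have ht0 : 0 < t := ht.1
  have hn1 : ((n - 1 : ℕ) : ℝ) = n - 1 := by rw [Nat.cast_sub hn]; simp
  simp only [finrank_euclideanSpace_fin, smul_eq_mul]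
  rw [← Real.rpow_natCast, ← Real.rpow_add ht0, hn1]
  ring_nf

lemma integrable_riesz_mul {n : ℕ} (hn : 0 < n) {α : ℝ} (hα : 0 ≤ α) (hαn : α < n)
    {f : Euc n → ℝ} (hf : ContinuousOn f {0}ᶜ) (hfi : Integrable f) {x : Euc n} (hx : x ≠ 0) :
    Integrable (fun y => ‖x - y‖ ^ (-α) * f y) := by
  have hx0 : 0 < ‖x‖ := norm_pos_iff.2 hx
  have hker : IntegrableOn (fun y : Euc n => ‖x - y‖ ^ (-α)) (closedBall x (‖x‖ / 2)) := by
    have h1 : Integrable ((ball (0 : Euc n) ‖x‖).indicator fun y => ‖y‖ ^ (-α)) :=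
      (integrable_indicator_iff measurableSet_ball).2 (integrableOn_norm_rpow_ball hn hαn hx0)
    refine (h1.comp_sub_left x).integrableOn.congr_fun (fun y hy => ?_) measurableSet_closedBall
    rw [mem_closedBall, dist_eq_norm, norm_sub_rev] at hy
    exact indicator_of_mem (mem_ball_zero_iff.2 (by linarith)) _
  rw [← integrableOn_univ, ← union_compl_self (closedBall x (‖x‖ / 2))]
  refine IntegrableOn.union ?_ ?_
  · refine hker.mul_continuousOn (hf.mono fun y hy => ?_) (isCompact_closedBall _ _)
    rintro rfl
    rw [mem_closedBall, dist_eq_norm, zero_sub, norm_neg] at hy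
    linarith
  · refine hfi.integrableOn.bdd_mul (c := (‖x‖ / 2) ^ (-α)) ?_ ?_
    · exact (by fun_prop : Measurable fun y : Euc n => ‖x - y‖ ^ (-α)).aestronglyMeasurable
    · refine (ae_restrict_iff' measurableSet_closedBall.compl).2 (ae_of_all _ fun y hy => ?_)
      rw [mem_compl_iff, mem_closedBall, dist_eq_norm, norm_sub_rev, not_le] at hy
      rw [Real.norm_of_nonneg (by positivity)]
      exact Real.rpow_le_rpow_of_nonpos (by positivity) hy.le (by linarith)

lemma le_integral_riesz_mul {n : ℕ} {α : ℝ} (hn : 0 < n) (hα : 0 ≤ α) {f : Euc n → ℝ}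
    (hf0 : ∀ y, 0 ≤ f y) (hf1 : ∀ y ∈ ball (0 : Euc n) 1, 1 ≤ f y) {x : Euc n}
    (hx : x ∈ ball (0 : Euc n) 2) (hint : Integrable (fun y => ‖x - y‖ ^ (-α) * f y)) :
    3 ^ (-α) * volume.real (ball (0 : Euc n) 1) ≤ ∫ y, ‖x - y‖ ^ (-α) * f y := by
  have : Nonempty (Fin n) := ⟨⟨0, hn⟩⟩
  have hne : ∀ᵐ y : Euc n, y ≠ x := compl_mem_ae_iff.2 (measure_singleton x)
  calc (3 : ℝ) ^ (-α) * volume.real (ball (0 : Euc n) 1)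
      = ∫ _ in ball (0 : Euc n) 1, (3 : ℝ) ^ (-α) := by simp [mul_comm]
    _ ≤ ∫ y in ball (0 : Euc n) 1, ‖x - y‖ ^ (-α) * f y := by
        refine setIntegral_mono_on_ae (integrableOn_const measure_ball_lt_top.ne) hint.integrableOn
          measurableSet_ball ?_
        filter_upwards [hne] with y hyx hy
        have h1 : ‖x - y‖ ≤ 3 := by
          have := norm_sub_le x y
          rw [mem_ball_zero_iff] at hx hy
          linarith
        have h2 : (3 : ℝ) ^ (-α) ≤ ‖x - y‖ ^ (-α) :=
          Real.rpow_le_rpow_of_nonpos (norm_pos_iff.2 (sub_ne_zero.2 hyx.symm)) h1 (by linarith)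
        exact h2.trans (le_mul_of_one_le_right (by positivity) (hf1 y hy))
    _ ≤ ∫ y, ‖x - y‖ ^ (-α) * f y :=
        setIntegral_le_integral hint (ae_of_all _ fun y => mul_nonneg (by positivity) (hf0 y))

/-- A function that is a.e. dominated by some term of a summable family of translates is
integrable. -/
lemma integrable_of_le_add_translate {n : ℕ} {f g h : Euc n → ℝ} {a : ℕ → ℝ} {c : ℕ → Euc n}
    (hf : AEStronglyMeasurable f volume) (hf0 : ∀ y, 0 ≤ f y) (hg : Integrable g)
    (hh : Integrable h) (ha : Summable a) (ha0 : ∀ j, 0 ≤ a j)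
    (hle : ∀ᵐ y, ∃ j, f y ≤ g y + a j * h (y - c j)) : Integrable f := by
  refine ⟨hf, ?_⟩
  have hmeas (j : ℕ) : AEMeasurable (fun y => ENNReal.ofReal (a j) * ‖h (y - c j)‖ₑ) volume :=
    (hh.comp_sub_right (c j)).aestronglyMeasurable.enorm.const_mul _
  have hsum : ∫⁻ y, ∑' j, ENNReal.ofReal (a j) * ‖h (y - c j)‖ₑ < ⊤ := by
    rw [lintegral_tsum hmeas]
    have (j : ℕ) : ∫⁻ y, ENNReal.ofReal (a j) * ‖h (y - c j)‖ₑ =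
        ENNReal.ofReal (a j) * ∫⁻ y, ‖h y‖ₑ := by
      rw [lintegral_const_mul' _ _ ENNReal.ofReal_ne_top,
        lintegral_sub_right_eq_self (fun y => ‖h y‖ₑ)]
    simp_rw [this]
    rw [ENNReal.tsum_mul_right, ← ENNReal.ofReal_tsum_of_nonneg ha0 ha]
    exact ENNReal.mul_lt_top ENNReal.ofReal_lt_top hh.2
  calc ∫⁻ y, ‖f y‖ₑ
      ≤ ∫⁻ y, (‖g y‖ₑ + ∑' j, ENNReal.ofReal (a j) * ‖h (y - c j)‖ₑ) := by
        refine lintegral_mono_ae ?_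
        filter_upwards [hle] with y ⟨j, hj⟩
        calc ‖f y‖ₑ = ENNReal.ofReal (f y) := Real.enorm_of_nonneg (hf0 y)
          _ ≤ ENNReal.ofReal (g y + a j * h (y - c j)) := ENNReal.ofReal_le_ofReal hj
          _ ≤ ‖g y + a j * h (y - c j)‖ₑ := Real.ofReal_le_enorm _
          _ ≤ ‖g y‖ₑ + ‖a j * h (y - c j)‖ₑ := enorm_add_le _ _
          _ = ‖g y‖ₑ + ENNReal.ofReal (a j) * ‖h (y - c j)‖ₑ := by
              rw [enorm_mul, Real.enorm_of_nonneg (ha0 j)]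
          _ ≤ _ := by gcongr; exact ENNReal.le_tsum j
    _ = (∫⁻ y, ‖g y‖ₑ) + ∫⁻ y, ∑' j, ENNReal.ofReal (a j) * ‖h (y - c j)‖ₑ :=
        lintegral_add_left' hg.aestronglyMeasurable.enorm _
    _ < ⊤ := ENNReal.add_lt_top.2 ⟨hg.2, hsum⟩

end Integrability

section Background

/-- A compactly supported function that equals `A - a |y|²` on `B₂(0)`. -/
noncomputable def background {n : ℕ} (A a : ℝ) (y : Euc n) : ℝ :=
  (A - a * ‖y‖ ^ 2) * (⟨2, 3, by norm_num, by norm_num⟩ : ContDiffBump (0 : Euc n)) y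

variable {n : ℕ} {A a : ℝ}

lemma contDiff_background : ContDiff ℝ 2 (background A a : Euc n → ℝ) :=
  (contDiff_const.sub (contDiff_const.mul (contDiff_norm_sq ℝ))).mul (ContDiffBump.contDiff _)

lemma hasCompactSupport_background : HasCompactSupport (background A a : Euc n → ℝ) :=
  (ContDiffBump.hasCompactSupport _).mul_left

lemma background_eq {y : Euc n} (hy : y ∈ ball (0 : Euc n) 2) :
    background A a y = A - a * ‖y‖ ^ 2 := by
  rw [background, ContDiffBump.one_of_mem_closedBall _ (ball_subset_closedBall hy), mul_one]

lemma background_nonneg (ha : 0 ≤ a) (hA : 9 * a ≤ A) (y : Euc n) : 0 ≤ background A a y := by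
  rcases le_or_gt 3 ‖y‖ with h | h
  · rw [background, ContDiffBump.zero_of_le_dist _ (by simpa using h), mul_zero]
  · refine mul_nonneg ?_ (ContDiffBump.nonneg _)
    have : ‖y‖ ^ 2 ≤ 9 := by nlinarith [norm_nonneg y]
    nlinarith

lemma le_background (ha : 0 ≤ a) {y : Euc n} (hy : y ∈ ball (0 : Euc n) 2) :
    A - 4 * a ≤ background A a y := by
  rw [background_eq hy]
  rw [mem_ball_zero_iff] at hy
  have : ‖y‖ ^ 2 ≤ 4 := by nlinarith [norm_nonneg y]
  nlinarith

lemma integrable_background_rpow {p : ℝ} (hp : 0 < p) :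
    Integrable (fun y : Euc n => background A a y ^ p) := by
  refine Continuous.integrable_of_hasCompactSupport ?_ ?_
  · exact contDiff_background.continuous.rpow_const fun _ => Or.inr hp.le
  · exact hasCompactSupport_background.comp_left (g := fun t : ℝ => t ^ p) (Real.zero_rpow hp.ne')

lemma lap_const_sub_mul_norm_sq (x : Euc n) :
    lap (fun y : Euc n => A - a * ‖y‖ ^ 2) x = -(2 * n * a) := by
  have h := lap_comp_norm_sub_sq (G := fun t => A - a * t) (G' := fun _ => -a) (G'' := 0)
    (c := 0) (x := x)
    (.of_forall fun t => by simpa using ((hasDerivAt_id t).const_mul a).const_sub A)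
    (hasDerivAt_const _ _)
  simp only [sub_zero] at h
  rw [h]
  ring

end Background

section Spikes

/-- The centre of the `j`-th spike on the ray spanned by `e`. -/
noncomputable def spikeCenter {n : ℕ} (e : Euc n) (j : ℕ) : Euc n := (1 / 2 : ℝ) ^ (j + 1) • e

/-- The radius of the ball around `spikeCenter e j` that supports the `j`-th spike. -/
noncomputable def spikeRadius (j : ℕ) : ℝ := (1 / 2 : ℝ) ^ (j + 1) / 8

/-- The `j`-th spike. -/
noncomputable def spike {n : ℕ} (k : ℝ) (δ : ℕ → ℝ) (e : Euc n) (j : ℕ) (y : Euc n) : ℝ :=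
  bubble k (δ j) (spikeRadius j) (‖y - spikeCenter e j‖ ^ 2)

variable {n : ℕ} {k : ℝ} {δ : ℕ → ℝ} {e : Euc n}

lemma spikeRadius_pos (j : ℕ) : 0 < spikeRadius j := by unfold spikeRadius; positivity

lemma spikeRadius_le_one (j : ℕ) : spikeRadius j ≤ 1 := by
  have : (1 / 2 : ℝ) ^ (j + 1) ≤ 1 := pow_le_one₀ (by norm_num) (by norm_num)
  unfold spikeRadius; linarith

lemma norm_spikeCenter (he : ‖e‖ = 1) (j : ℕ) : ‖spikeCenter e j‖ = (1 / 2 : ℝ) ^ (j + 1) := by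
  rw [spikeCenter, norm_smul, he, mul_one, Real.norm_of_nonneg (by positivity)]

lemma spike_eq_zero (hk : 0 < k) (hδ : ∀ j, 0 < δ j) {j : ℕ} {y : Euc n}
    (h : spikeRadius j ≤ ‖y - spikeCenter e j‖) : spike k δ e j y = 0 :=
  bubble_eq_zero hk (hδ j) (spikeRadius_pos j)
    (pow_le_pow_left₀ (spikeRadius_pos j).le h 2)

lemma spikeRadius_le_norm_sub (he : ‖e‖ = 1) {i j : ℕ} (hij : i ≠ j) {y : Euc n}
    (hlow : 3 / 4 * (1 / 2 : ℝ) ^ (j + 1) < ‖y‖)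
    (hup : j = 0 ∨ ‖y‖ < 8 / 5 * (1 / 2 : ℝ) ^ (j + 1)) :
    spikeRadius i ≤ ‖y - spikeCenter e i‖ := by
  have hi := norm_spikeCenter he i
  have h0 : (0 : ℝ) < (1 / 2) ^ (i + 1) := by positivity
  unfold spikeRadius
  rcases lt_or_gt_of_ne hij with h | h
  · have hp : (1 / 2 : ℝ) ^ (j + 1) ≤ (1 / 2) ^ (i + 1 + 1) :=
      pow_le_pow_of_le_one (by norm_num) (by norm_num) (by omega)
    rw [pow_succ _ (i + 1)] at hp
    have hup' := hup.resolve_left (by omega)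
    have := norm_sub_norm_le (spikeCenter e i) y
    rw [norm_sub_rev] at this
    linarith
  · have hp : (1 / 2 : ℝ) ^ (i + 1) ≤ (1 / 2) ^ (j + 1 + 1) :=
      pow_le_pow_of_le_one (by norm_num) (by norm_num) (by omega)
    rw [pow_succ _ (j + 1)] at hp
    have := norm_sub_norm_le y (spikeCenter e i)
    linarith

lemma exists_eventually_spike_eq_zero (hk : 0 < k) (hδ : ∀ j, 0 < δ j) (he : ‖e‖ = 1)
    {x : Euc n} (hx : x ≠ 0) :
    ∃ j, ∀ᶠ y in 𝓝 x, ∀ i ≠ j, spike k δ e i y = 0 := by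
  have hcont : ContinuousAt (fun y : Euc n => ‖y‖) x := continuous_norm.continuousAt
  have hx0 : 0 < ‖x‖ := norm_pos_iff.2 hx
  rcases lt_or_ge (3 / 4) ‖x‖ with h | h
  · refine ⟨0, ?_⟩
    filter_upwards [hcont.eventually_const_lt h] with y hy i hi
    exact spike_eq_zero hk hδ (spikeRadius_le_norm_sub he hi (by norm_num; linarith) (Or.inl rfl))
  · obtain ⟨m, hm1, hm2⟩ := exists_nat_pow_near_of_lt_one (x := ‖x‖ / (3 / 4)) (by positivity)
      ((div_le_one (by norm_num)).2 h) (by norm_num : (0 : ℝ) < 1 / 2) (by norm_num)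
    have hp : (0 : ℝ) < (1 / 2) ^ m := by positivity
    have hps := pow_succ (1 / 2 : ℝ) m
    refine ⟨m, ?_⟩
    have h1 : 3 / 4 * (1 / 2 : ℝ) ^ (m + 1) < ‖x‖ := by linarith
    have h2 : ‖x‖ < 8 / 5 * (1 / 2 : ℝ) ^ (m + 1) := by linarith
    filter_upwards [hcont.eventually_const_lt h1, hcont.eventually_lt_const h2] with y hy1 hy2 i hi
    exact spike_eq_zero hk hδ (spikeRadius_le_norm_sub he hi hy1 (Or.inr hy2))

lemma contDiff_spike (hδ : ∀ j, 0 < δ j) (j : ℕ) : ContDiff ℝ 2 (spike k δ e j) := by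
  refine contDiff_iff_contDiffAt.2 fun y => ?_
  have hS : 0 < δ j + ‖y - spikeCenter e j‖ ^ 2 := by have := hδ j; positivity
  exact (contDiffAt_bubble hS).comp y
    ((contDiff_norm_sq ℝ).comp (contDiff_id.sub contDiff_const)).contDiffAt

lemma spike_rpow_le (hk : 0 < k) (hδ : ∀ j, 0 < δ j) {p : ℝ} (hp : 0 < p) {j : ℕ} {y : Euc n}
    (hy : y ≠ spikeCenter e j) :
    spike k δ e j y ^ p ≤ (spikeRadius j ^ 2) ^ p *
      (ball (0 : Euc n) 1).indicator (fun z => ‖z‖ ^ (-(2 * k * p))) (y - spikeCenter e j) := by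
  have hr := spikeRadius_pos j
  have hr1 := spikeRadius_le_one j
  rcases le_or_gt (spikeRadius j) ‖y - spikeCenter e j‖ with h | h
  · rw [spike_eq_zero hk hδ h, Real.zero_rpow hp.ne']
    exact mul_nonneg (by positivity) (indicator_nonneg (fun z _ => by positivity) _)
  have hpos : 0 < ‖y - spikeCenter e j‖ := norm_pos_iff.2 (sub_ne_zero.2 hy)
  rw [indicator_of_mem (mem_ball_zero_iff.2 (h.trans_le hr1))]
  have h1 : spike k δ e j y ≤ spikeRadius j ^ 2 * ‖y - spikeCenter e j‖ ^ (-(2 * k)) := by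
    refine (bubble_le hk (hδ j) hr (by positivity)).trans ?_
    rw [← Real.rpow_natCast ‖_‖, ← Real.rpow_mul hpos.le]
    push_cast
    rw [mul_neg]
    refine mul_le_mul_of_nonneg_right ?_ (by positivity)
    exact mul_le_of_le_one_right (by positivity) (Real.rpow_le_one hr.le hr1 (by positivity))
  refine (Real.rpow_le_rpow (bubble_nonneg _ _ _ _) h1 hp.le).trans_eq ?_
  rw [Real.mul_rpow (by positivity) (by positivity), ← Real.rpow_mul hpos.le]
  ring_nf

lemma summable_spikeRadius_rpow {p : ℝ} (hp : 0 < p) :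
    Summable fun j => (spikeRadius j ^ 2) ^ p := by
  have (j : ℕ) : (spikeRadius j ^ 2) ^ p = (1 / 256) ^ p * ((1 / 4 : ℝ) ^ p) ^ j := by
    rw [Real.rpow_pow_comm (by norm_num), ← Real.mul_rpow (by norm_num) (by positivity)]
    congr 1
    rw [spikeRadius, show (1 / 4 : ℝ) = (1 / 2) ^ 2 by norm_num, ← pow_mul]
    ring
  simp_rw [this]
  exact (summable_geometric_of_lt_one (by positivity)
    (Real.rpow_lt_one (by norm_num) (by norm_num) hp)).mul_left _

end Spikes

section Construction

variable {n : ℕ} {A a k : ℝ} {δ : ℕ → ℝ} {e : Euc n}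

/-- The background together with all spikes. -/
noncomputable def spikySum (A a k : ℝ) (δ : ℕ → ℝ) (e : Euc n) (y : Euc n) : ℝ :=
  background A a y + ∑' j, spike k δ e j y

lemma spike_nonneg (j : ℕ) (y : Euc n) : 0 ≤ spike k δ e j y := bubble_nonneg _ _ _ _

lemma background_le_spikySum (y : Euc n) : background A a y ≤ spikySum A a k δ e y :=
  le_add_of_nonneg_right (tsum_nonneg fun j => spike_nonneg j y)

lemma spikySum_eventuallyEq (hk : 0 < k) (hδ : ∀ j, 0 < δ j) (he : ‖e‖ = 1) {x : Euc n}
    (hx : x ≠ 0) :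
    ∃ j, spikySum A a k δ e =ᶠ[𝓝 x] fun y => background A a y + spike k δ e j y := by
  obtain ⟨j, hj⟩ := exists_eventually_spike_eq_zero hk hδ he hx
  refine ⟨j, ?_⟩
  filter_upwards [hj] with y hy
  rw [spikySum, tsum_eq_single j hy]

lemma background_add_spike_le_spikySum (hk : 0 < k) (hδ : ∀ j, 0 < δ j) (he : ‖e‖ = 1)
    {x : Euc n} (hx : x ≠ 0) (j : ℕ) :
    background A a x + spike k δ e j x ≤ spikySum A a k δ e x := by
  obtain ⟨i, hi⟩ := exists_eventually_spike_eq_zero hk hδ he hx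
  refine add_le_add le_rfl (Summable.le_tsum ?_ j fun l _ => spike_nonneg l x)
  exact summable_of_ne_finset_zero (s := {i}) fun l hl => hi.self_of_nhds l (by simpa using hl)

lemma contDiffOn_spikySum (hk : 0 < k) (hδ : ∀ j, 0 < δ j) (he : ‖e‖ = 1) :
    ContDiffOn ℝ 2 (spikySum A a k δ e) {0}ᶜ := by
  intro x hx
  obtain ⟨j, hj⟩ := spikySum_eventuallyEq (A := A) (a := a) hk hδ he hx
  exact ((contDiff_background.add
    (contDiff_spike hδ j)).contDiffAt.congr_of_eventuallyEq hj).contDiffWithinAt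

lemma add_rpow_le {s t p : ℝ} (hs : 0 ≤ s) (ht : 0 ≤ t) (hp : 0 ≤ p) :
    (s + t) ^ p ≤ 2 ^ p * s ^ p + 2 ^ p * t ^ p := by
  rw [← Real.mul_rpow zero_le_two hs, ← Real.mul_rpow zero_le_two ht]
  rcases le_total s t with h | h
  · exact (Real.rpow_le_rpow (by positivity) (by linarith) hp).trans
      (le_add_of_nonneg_left (by positivity))
  · exact (Real.rpow_le_rpow (by positivity) (by linarith) hp).trans
      (le_add_of_nonneg_right (by positivity))

lemma integrable_spikySum_rpow (hn : 0 < n) (hk : 0 < k) (hδ : ∀ j, 0 < δ j) (he : ‖e‖ = 1)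
    (ha : 0 ≤ a) (hA : 9 * a ≤ A) {p : ℝ} (hp : 0 < p) (hpn : 2 * k * p < n) :
    Integrable fun y => spikySum A a k δ e y ^ p := by
  have : Nonempty (Fin n) := ⟨⟨0, hn⟩⟩
  have hnn (y : Euc n) : 0 ≤ spikySum A a k δ e y :=
    (background_nonneg ha hA y).trans (background_le_spikySum y)
  have hmeas : AEStronglyMeasurable (fun y => spikySum A a k δ e y ^ p) volume := by
    rw [← restrict_compl_singleton (μ := volume) (0 : Euc n)]
    exact ((contDiffOn_spikySum hk hδ he).continuousOn.rpow_const
      fun _ _ => Or.inr hp.le).aestronglyMeasurable (measurableSet_singleton _).compl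
  refine integrable_of_le_add_translate (a := fun j => 2 ^ p * (spikeRadius j ^ 2) ^ p)
    (c := spikeCenter e) hmeas (fun y => Real.rpow_nonneg (hnn y) p)
    ((integrable_background_rpow (A := A) (a := a) hp).const_mul (2 ^ p))
    ((integrable_indicator_iff measurableSet_ball).2
      (integrableOn_norm_rpow_ball hn hpn zero_lt_one))
    ((summable_spikeRadius_rpow hp).mul_left _) (fun j => by positivity) ?_
  filter_upwards [Measure.ae_ne volume 0, ae_all_iff.2 fun j => Measure.ae_ne volume
    (spikeCenter e j)] with y hy0 hyc
  obtain ⟨j, hj⟩ := spikySum_eventuallyEq (A := A) (a := a) hk hδ he hy0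
  refine ⟨j, ?_⟩
  rw [hj.self_of_nhds]
  refine (add_rpow_le (background_nonneg ha hA y) (spike_nonneg j y) hp.le).trans ?_
  rw [mul_assoc]
  gcongr
  exact spike_rpow_le hk hδ hp (hyc j)

lemma lap_spikySum (hk : 0 < k) (hδ : ∀ j, 0 < δ j) (he : ‖e‖ = 1) {x : Euc n} (hx0 : x ≠ 0)
    (hx : x ∈ ball (0 : Euc n) 2) :
    ∃ j, lap (spikySum A a k δ e) x = -(2 * n * a) + lap (spike k δ e j) x := by
  obtain ⟨j, hj⟩ := spikySum_eventuallyEq (A := A) (a := a) hk hδ he hx0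
  refine ⟨j, ?_⟩
  have hloc : spikySum A a k δ e =ᶠ[𝓝 x]
      ((fun y => A - a * ‖y‖ ^ 2) + spike k δ e j : Euc n → ℝ) := by
    filter_upwards [hj, isOpen_ball.mem_nhds hx] with y hy hy2
    rw [hy, background_eq hy2, Pi.add_apply]
  have hsq : ContDiff ℝ 2 fun y : Euc n => A - a * ‖y‖ ^ 2 :=
    contDiff_const.sub (contDiff_const.mul (contDiff_norm_sq ℝ))
  rw [← lap_const_sub_mul_norm_sq (A := A) (a := a) x]
  simp only [lap, ← Finset.sum_add_distrib]
  refine Finset.sum_congr rfl fun i _ => ?_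
  rw [(hloc.iteratedFDeriv ℝ 2).self_of_nhds,
    iteratedFDeriv_add_apply hsq.contDiffAt (contDiff_spike hδ j).contDiffAt]
  rfl

end Construction

/-- The scalar conditions under which `spikySum` satisfies the differential inequality. -/
lemma spikySum_neg_lap_bounds {n : ℕ} {A a k C κ M τ sig : ℝ} {δ : ℕ → ℝ} {e : Euc n}
    (hn : 0 < n) (hk : 1 / 2 ≤ k) (hkn : 2 * k + 2 = n) (hδ : ∀ j, 0 < δ j) (he : ‖e‖ = 1)
    (hC0 : 0 ≤ C) (hC : ∀ t, deriv truncation t ≤ C ∧ |deriv (deriv truncation) t| ≤ C)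
    (ha : 2 * n * a = C * (64 * k ^ 2)) (hA : A = 9 * a + M + 2)
    (hκ : 0 < κ) (hM1 : 1 ≤ M) (hM : 2 * (C * (64 * k ^ 2)) ≤ κ / 2 * M)
    (hτ1 : 1 ≤ τ) (hτs : τ ≤ sig) (hτk : k * τ ≤ k + 2)
    (hconc : ∀ j, C * (2 * n * k) * δ j ^ (k * τ - k - 1) ≤
      κ / 2 * (spikeRadius j ^ 2 * spikeRadius j ^ (2 * k)) ^ (τ - 1))
    {x : Euc n} (hx0 : x ≠ 0) (hx : x ∈ ball (0 : Euc n) 2) :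
    0 ≤ -lap (spikySum A a k δ e) x ∧
      -lap (spikySum A a k δ e) x ≤ κ * spikySum A a k δ e x ^ sig := by
  have hk0 : 0 < k := by linarith
  have hn' : (0 : ℝ) < n := Nat.cast_pos.2 hn
  have ha0 : 0 ≤ a := by
    have : 0 ≤ 2 * n * a := ha ▸ by positivity
    exact nonneg_of_mul_nonneg_right this (by positivity)
  obtain ⟨j, hj⟩ := lap_spikySum (A := A) (a := a) hk0 hδ he hx0 hx
  set u := spikySum A a k δ e x
  have hr := spikeRadius_pos j
  set q := spikeRadius j ^ 2 * spikeRadius j ^ (2 * k)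
  set S := δ j + ‖x - spikeCenter e j‖ ^ 2
  have hS : δ j ≤ S := le_add_of_nonneg_right (sq_nonneg _)
  have hS0 : 0 < S := (hδ j).trans_le hS
  obtain ⟨hlow, hup⟩ := neg_lap_bubble_bounds hk hkn (hδ j) hr hC (spikeCenter e j) x
  change -(C * (64 * k ^ 2)) ≤ -lap (spike k δ e j) x at hlow
  change -lap (spike k δ e j) x ≤ _ at hup
  rw [hj]
  refine ⟨by linarith, ?_⟩
  have hu : M + q * S ^ (-k) ≤ u := by
    have h1 := background_add_spike_le_spikySum (A := A) (a := a) hk0 hδ he hx0 j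
    have h2 := le_background (A := A) ha0 hx
    have h3 : q * S ^ (-k) - 2 ≤ spike k δ e j x := le_bubble hr (spikeRadius_le_one j)
    linarith
  have hpos : 0 < q * S ^ (-k) := by positivity
  have h1 : M ≤ u ^ τ := by
    calc M = M ^ (1 : ℝ) := (Real.rpow_one M).symm
      _ ≤ M ^ τ := Real.rpow_le_rpow_of_exponent_le hM1 hτ1
      _ ≤ u ^ τ := Real.rpow_le_rpow (by linarith) (by linarith) (by linarith)
  have h2 : (q * S ^ (-k)) ^ τ ≤ u ^ τ :=
    Real.rpow_le_rpow hpos.le (by linarith) (by linarith)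
  have h3 : u ^ τ ≤ u ^ sig := Real.rpow_le_rpow_of_exponent_le (by linarith) hτs
  have h4 : C * (2 * n * k) * (q * (δ j * S ^ (-k - 2))) ≤ κ / 2 * (q * S ^ (-k)) ^ τ :=
    bubble_source_le (by positivity) (hδ j) hS (by positivity) hτk (hconc j)
  have h5 : κ / 2 * M ≤ κ / 2 * u ^ τ := by gcongr
  have h6 : κ / 2 * (q * S ^ (-k)) ^ τ ≤ κ / 2 * u ^ τ := by gcongr
  have h7 : κ * u ^ τ ≤ κ * u ^ sig := by gcongr
  linarith

theorem stmt10 (n : ℕ) (hn : 3 ≤ n) (α lam sig : ℝ)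
    (hα0 : 0 < α) (hαn : α < n)
    (hlam0 : 0 < lam) (hlam1 : lam < ((n : ℝ) - α) / ((n : ℝ) - 2))
    (hsig : (n : ℝ) / ((n : ℝ) - 2) < sig)
    (φ : ℝ → ℝ) (hφc : ContinuousOn φ (Ioo 0 1))
    (hφp : ∀ t ∈ Ioo (0:ℝ) 1, 0 < φ t)
    (hφl : Tendsto φ (𝓝[>] (0:ℝ)) atTop) :
    ∃ u : Euc n → ℝ, IsCPSolution n α lam sig u ∧ NotBigOAt n u φ := by
  have hn0 : 0 < n := by omega
  have hn3 : (3 : ℝ) ≤ n := by exact_mod_cast hn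
  have hn2 : (0 : ℝ) < n - 2 := by linarith
  obtain ⟨k, hkn⟩ : ∃ k : ℝ, 2 * k + 2 = n := ⟨(n - 2) / 2, by ring⟩
  have hk : 1 / 2 ≤ k := by linarith
  have hk0 : 0 < k := by linarith
  obtain ⟨C, hC0, hC⟩ := exists_deriv_truncation_le
  have : Nonempty (Fin n) := ⟨⟨0, hn0⟩⟩
  obtain ⟨e, he⟩ : ∃ e : Euc n, ‖e‖ = 1 := ⟨EuclideanSpace.single ⟨0, hn0⟩ 1, by simp⟩
  set κ := (3 : ℝ) ^ (-α) * volume.real (ball (0 : Euc n) 1)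
  have hκ : 0 < κ := mul_pos (by positivity)
    (ENNReal.toReal_pos (measure_ball_pos _ _ zero_lt_one).ne' measure_ball_lt_top.ne)
  set τ := min sig ((k + 2) / k)
  have hτk : k * τ ≤ k + 2 := by
    rw [mul_comm, ← le_div_iff₀ hk0]; exact min_le_right _ _
  have hτ : (k + 1) / k < τ := by
    refine lt_min ?_ (div_lt_div_of_pos_right (by linarith) hk0)
    refine lt_of_eq_of_lt ?_ hsig
    rw [div_eq_div_iff hk0.ne' hn2.ne', ← hkn]
    ring
  have hθ : 0 < k * τ - k - 1 := by
    rw [div_lt_iff₀ hk0] at hτ; linarith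
  have hτ1 : 1 ≤ τ := by nlinarith
  have hq (j : ℕ) : 0 < spikeRadius j ^ 2 * spikeRadius j ^ (2 * k) := by
    have := spikeRadius_pos j; positivity
  choose δ hδ hconc hlarge using fun j : ℕ =>
    exists_concentration (k := k) (D := C * (2 * n * k))
      (E := κ / 2 * (spikeRadius j ^ 2 * spikeRadius j ^ (2 * k)) ^ (τ - 1))
      (N := j * φ ((1 / 2) ^ (j + 1))) hk0 hθ
      (mul_pos (half_pos hκ) (Real.rpow_pos_of_pos (hq j) _)) (hq j)
  set K := C * (64 * k ^ 2)
  have hK0 : 0 ≤ K := by positivity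
  obtain ⟨a, ha⟩ : ∃ a : ℝ, 2 * n * a = K := ⟨K / (2 * n), by field_simp⟩
  have ha0 : 0 ≤ a := nonneg_of_mul_nonneg_right (ha ▸ hK0 : 0 ≤ 2 * n * a) (by positivity)
  set M := 1 + 4 * K / κ with hMdef
  have hM1 : 1 ≤ M := le_add_of_nonneg_right (by positivity)
  have hM : 2 * K ≤ κ / 2 * M := by
    have : κ / 2 * M = κ / 2 + 2 * K := by rw [hMdef]; field_simp; ring
    linarith
  set A := 9 * a + M + 2 with hA
  have hA9 : 9 * a ≤ A := by linarith
  set u : Euc n → ℝ := spikySum A a k δ e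
  have hu0 (y : Euc n) : 0 ≤ u y := (background_nonneg ha0 hA9 y).trans (background_le_spikySum y)
  have hu1 {y : Euc n} (hy : y ∈ ball (0 : Euc n) 2) : 1 ≤ u y := by
    have h1 := le_background (A := A) ha0 hy
    have h2 : background A a y ≤ u y := background_le_spikySum y
    linarith
  have hreg : ContDiffOn ℝ 2 u {0}ᶜ := contDiffOn_spikySum hk0 hδ he
  have hint : Integrable fun y => u y ^ lam := by
    refine integrable_spikySum_rpow hn0 hk0 hδ he ha0 hA9 hlam0 ?_
    rw [lt_div_iff₀ hn2] at hlam1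
    have : 2 * k * lam = lam * (n - 2) := by rw [← hkn]; ring
    linarith
  refine ⟨u, ⟨hu0, hreg, hint, fun x hx => ?_⟩, spikeCenter e, fun j => ?_, ?_, ?_⟩
  · have hx0 : x ≠ 0 := hx.2
    obtain ⟨h1, h2⟩ := spikySum_neg_lap_bounds hn0 hk hkn hδ he hC0 hC ha hA hκ hM1 hM hτ1
      (min_le_left _ _) hτk hconc hx0 hx.1
    refine ⟨h1, h2.trans (mul_le_mul_of_nonneg_right ?_ (Real.rpow_nonneg (hu0 x) _))⟩
    refine le_integral_riesz_mul hn0 hα0.le (fun y => Real.rpow_nonneg (hu0 y) _)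
      (fun y hy => Real.one_le_rpow (hu1 (ball_subset_ball one_le_two hy)) hlam0.le) hx.1 ?_
    exact integrable_riesz_mul hn0 hα0.le hαn
      (hreg.continuousOn.rpow_const fun _ _ => Or.inr hlam0.le) hint hx0
  · rw [← norm_pos_iff, norm_spikeCenter he]; positivity
  · rw [tendsto_zero_iff_norm_tendsto_zero]
    simp_rw [norm_spikeCenter he]
    exact (tendsto_pow_atTop_nhds_zero_of_lt_one (by norm_num) (by norm_num)).comp
      (tendsto_add_atTop_nat 1)
  · refine tendsto_atTop_mono (fun j => ?_) tendsto_natCast_atTop_atTop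
    have hd : (1 / 2 : ℝ) ^ (j + 1) < 1 := pow_lt_one₀ (by norm_num) (by norm_num) (by simp)
    have hd0 : (0 : ℝ) < (1 / 2) ^ (j + 1) := by positivity
    have hc0 : spikeCenter e j ≠ 0 := by rw [← norm_pos_iff, norm_spikeCenter he]; exact hd0
    have hc2 : spikeCenter e j ∈ ball (0 : Euc n) 2 := by
      rw [mem_ball_zero_iff, norm_spikeCenter he]; linarith
    rw [norm_spikeCenter he, le_div_iff₀ (hφp _ ⟨hd0, hd⟩)]
    have h1 := background_add_spike_le_spikySum (A := A) (a := a) hk0 hδ he hc0 j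
    have h2 := le_background (A := A) ha0 hc2
    have h3 := le_bubble (k := k) (δ := δ j) (s := ‖spikeCenter e j - spikeCenter e j‖ ^ 2)
      (spikeRadius_pos j) (spikeRadius_le_one j)
    change _ ≤ spike k δ e j (spikeCenter e j) at h3
    simp only [sub_self, norm_zero, ne_eq, OfNat.ofNat_ne_zero, not_false_eq_true, zero_pow,
      add_zero] at h3
    have h4 := hlarge j
    change _ ≤ u _ at h1
    linarith
end
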